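/- arXiv:0909.3141 — 2 statements merged into one kernel-verified Lean document; each statement's English description precedes it below -/
import Mathlib

section
/- Let n ∈ ℕ, h > 0, and let u : ℝ_h → ℝⁿ be a mesh function with ‖u‖_{L²_h} < ∞. Define U : ℝ → ℝⁿ by U(x) = Σ_{l∈ℤ} u(x_l) · sin((π/h)(x_l − x)) / ((π/h)(x_l − x)), where the summand is understood to equal u(x_l) when x = x_l. Then: (1) U is infinitely differentiable on ℝ; (2) U(x_l) = u(x_l) for every l ∈ ℤ; (3) U ∈ L²(ℝ → ℝⁿ) with ‖U‖_{L²(ℝ)} = ‖u‖_{L²_h}, so that u ↦ U defines a linear isometry I_h : L²_h → L²(ℝ); and (4) for every integer j > 0, (2/π)^j ‖d^j U/dx^j‖_{L²(ℝ)} ≤ ‖D₊^j u‖_{L²_h} ≤ ‖d^j U/dx^j‖_{L²(ℝ)}. -/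
open MeasureTheory

noncomputable section

/-- The (unnormalized) sinc function, `sinc y = sin y / y` with `sinc 0 = 1`. -/
def sinc (y : ℝ) : ℝ := if y = 0 then 1 else Real.sin y / y

/-- Forward difference operator with mesh size `h` for `ℝⁿ`-valued mesh functions. -/
def DpV (d : ℕ) (h : ℝ) (u : ℤ → EuclideanSpace ℝ (Fin d)) : ℤ → EuclideanSpace ℝ (Fin d) :=
  fun l => h⁻¹ • (u (l + 1) - u l)

/-- The cardinal series (Stummel smoothing operator) `I_h u (x) =
Σ_l u(x_l) sin((π/h)(x_l − x)) / ((π/h)(x_l − x))`. -/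
def cardinal (d : ℕ) (h : ℝ) (u : ℤ → EuclideanSpace ℝ (Fin d)) (x : ℝ) :
    EuclideanSpace ℝ (Fin d) :=
  ∑' l : ℤ, sinc ((Real.pi / h) * ((l : ℝ) * h - x)) • u l

section
open Set Complex AddCircle

instance fact_two_pi_pos : Fact (0 < 2 * Real.pi) := ⟨Real.two_pi_pos⟩

/-- The normalized Haar measure on the circle `ℝ / 2πℤ`. -/
abbrev circleMeasure : Measure (AddCircle (2 * Real.pi)) := haarAddCircle

/-- The representative in `(-π, π]` of a point of the circle `ℝ / 2πℤ`. -/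
def angle (t : AddCircle (2 * Real.pi)) : ℝ := measurableEquivIoc (2 * Real.pi) (-Real.pi) t

lemma measurable_angle : Measurable angle :=
  measurable_subtype_coe.comp (measurableEquivIoc (2 * Real.pi) (-Real.pi)).measurable

lemma abs_angle_le (t : AddCircle (2 * Real.pi)) : |angle t| ≤ Real.pi := by
  have h := (measurableEquivIoc (2 * Real.pi) (-Real.pi) t).2
  rw [mem_Ioc] at h
  rw [abs_le, angle]
  constructor <;> linarith [h.1, h.2]

lemma coe_angle (t : AddCircle (2 * Real.pi)) : (angle t : AddCircle (2 * Real.pi)) = t :=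
  AddCircle.coe_equivIoc (p := 2 * Real.pi) (a := -Real.pi)

lemma angle_coe {x : ℝ} (hx : x ∈ Ioc (-Real.pi) Real.pi) : angle x = x :=
  equivIoc_coe_of_mem (p := 2 * Real.pi) (a := -Real.pi) (y := x)
    (by rwa [show -Real.pi + 2 * Real.pi = Real.pi by ring])

lemma fourier_eq_exp_angle (n : ℤ) (t : AddCircle (2 * Real.pi)) :
    fourier n t = exp (I * angle t * n) := by
  conv_lhs => rw [← coe_angle t]
  rw [fourier_coe_apply]
  congr 1
  have : (Real.pi : ℂ) ≠ 0 := by exact_mod_cast Real.pi_ne_zero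
  push_cast
  field_simp

lemma integral_exp_angle (s : ℝ) :
    ∫ t, exp (I * angle t * s) ∂circleMeasure = sinc (Real.pi * s) := by
  have hpi : (Real.pi : ℂ) ≠ 0 := by exact_mod_cast Real.pi_ne_zero
  rw [integral_haarAddCircle, ← AddCircle.intervalIntegral_preimage (2 * Real.pi) (-Real.pi)]
  have h1 : ∫ x in (-Real.pi)..(-Real.pi + 2 * Real.pi), exp (I * angle (x : AddCircle (2 * Real.pi)) * s)
      = ∫ x in (-Real.pi)..Real.pi, exp (I * s * x) := by
    rw [show -Real.pi + 2 * Real.pi = Real.pi by ring]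
    apply intervalIntegral.integral_congr_ae
    refine .of_forall fun x hx ↦ ?_
    rw [uIoc_of_le (by linarith [Real.pi_pos])] at hx
    rw [angle_coe hx]
    ring_nf
  rw [h1]
  by_cases hs : s = 0
  · subst hs
    simp [sinc]
    field_simp
    norm_num
  · have hs' : (s : ℂ) ≠ 0 := by exact_mod_cast hs
    rw [integral_exp_mul_complex (by simp [hs]), sinc,
      if_neg (mul_ne_zero Real.pi_ne_zero hs)]
    push_cast
    rw [Complex.sin, Complex.real_smul]
    rw [show I * s * (-Real.pi : ℂ) = -(Real.pi * s) * I by ring,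
      show I * s * (Real.pi : ℂ) = (Real.pi * s) * I by ring]
    have : (I : ℂ) ≠ 0 := I_ne_zero
    push_cast
    field_simp
    ring_nf
    simp
    ring

lemma MeasureTheory.MemLp.hasSum_sq_fourierCoeff {f : AddCircle (2 * Real.pi) → ℂ}
    (hf : MemLp f 2 circleMeasure) :
    HasSum (fun n => ‖fourierCoeff f n‖ ^ 2) (∫ t, ‖f t‖ ^ 2 ∂circleMeasure) := by
  convert _root_.hasSum_sq_fourierCoeff hf.toLp using 1
  · simp [fourierCoeff_congr_ae hf.coeFn_toLp]
  · apply integral_congr_ae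
    filter_upwards [hf.coeFn_toLp] with x hx
    simp [hx]

lemma exists_memLp_fourierCoeff_eq {c : ℤ → ℂ} (hc : Summable fun l => ‖c l‖ ^ 2) :
    ∃ g : AddCircle (2 * Real.pi) → ℂ, MemLp g 2 circleMeasure ∧ fourierCoeff g = c := by
  have hmem : Memℓp c 2 := memℓp_gen (by simpa using hc)
  let g := (fourierBasis (T := 2 * Real.pi)).repr.symm ⟨c, hmem⟩
  refine ⟨g, Lp.memLp g, ?_⟩
  ext l
  rw [← fourierBasis_repr]
  simp [g]

/-- Translating `ℝ` by the period lattice: a nonnegative continuous function whose sums over all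
translates of `hℤ` are constant has integral `h` times that constant. -/
lemma integrable_and_integral_of_hasSum_translates {h C : ℝ} (hh : 0 < h) {f : ℝ → ℝ}
    (hf : Continuous f) (hf0 : ∀ x, 0 ≤ f x) (hC : ∀ t : ℝ, HasSum (fun l : ℤ => f (l * h + t)) C) :
    Integrable f ∧ ∫ x, f x = C * h := by
  have hC0 : 0 ≤ C := (hC 0).nonneg fun l => hf0 _
  have hmeas : Measurable fun x => ENNReal.ofReal (f x) := hf.measurable.ennreal_ofReal
  have key : ∫⁻ x, ENNReal.ofReal (f x) = ENNReal.ofReal (C * h) := by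
    rw [← setLIntegral_univ, ← iUnion_Ioc_zsmul hh,
      lintegral_iUnion (fun _ => measurableSet_Ioc) (pairwise_disjoint_Ioc_zsmul h)]
    have h1 (l : ℤ) : ∫⁻ x in Ioc (l • h) ((l + 1) • h), ENNReal.ofReal (f x)
        = ∫⁻ t in Ioc 0 h, ENNReal.ofReal (f (l * h + t)) := by
      have hp := (measurePreserving_add_left volume ((l : ℝ) * h)).setLIntegral_comp_preimage
        (measurableSet_Ioc (a := l • h) (b := (l + 1) • h)) hmeas
      rw [← hp]
      congr 2
      ext x
      simp only [zsmul_eq_mul, mem_preimage, mem_Ioc]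
      push_cast
      constructor <;> rintro ⟨h1, h2⟩ <;> constructor <;> linarith
    simp_rw [h1]
    rw [← lintegral_tsum (f := fun (l : ℤ) t => ENNReal.ofReal (f (l * h + t)))
      fun l => (hmeas.comp (measurable_const_add _)).aemeasurable]
    have h2 (t : ℝ) : ∑' l : ℤ, ENNReal.ofReal (f (l * h + t)) = ENNReal.ofReal C := by
      rw [← ENNReal.ofReal_tsum_of_nonneg (fun l => hf0 _) (hC t).summable, (hC t).tsum_eq]
    simp_rw [h2]
    simp [ENNReal.ofReal_mul hC0]
  have hint : Integrable f := by
    refine ⟨hf.aestronglyMeasurable, ?_⟩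
    rw [hasFiniteIntegral_iff_ofReal (.of_forall hf0), key]
    exact ENNReal.ofReal_lt_top
  refine ⟨hint, ?_⟩
  rw [integral_eq_lintegral_of_nonneg_ae (.of_forall hf0) hf.aestronglyMeasurable, key,
    ENNReal.toReal_ofReal (by positivity)]

lemma memLp_mul_of_norm_le {m g : AddCircle (2 * Real.pi) → ℂ} {C : ℝ}
    (hg : MemLp g 2 circleMeasure) (hm : Measurable m) (hC : ∀ t, ‖m t‖ ≤ C) :
    MemLp (fun t => m t * g t) 2 circleMeasure :=
  hg.of_le_mul (hm.aestronglyMeasurable.mul hg.1)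
    (.of_forall fun t => by rw [norm_mul]; gcongr; exact hC t)

/-- The symbol of differentiation of band-limited functions with mesh size `h`. -/
def derivSymbol (h : ℝ) (t : AddCircle (2 * Real.pi)) : ℂ := -(I * angle t) / h

/-- The symbol of the forward difference operator with mesh size `h`. -/
def diffSymbol (h : ℝ) (t : AddCircle (2 * Real.pi)) : ℂ := (exp (-(I * angle t)) - 1) / h

@[fun_prop]
lemma measurable_derivSymbol (h : ℝ) : Measurable (derivSymbol h) := by
  have := measurable_angle
  unfold derivSymbol
  fun_prop

@[fun_prop]
lemma measurable_diffSymbol (h : ℝ) : Measurable (diffSymbol h) := by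
  have := measurable_angle
  unfold diffSymbol
  fun_prop

lemma norm_derivSymbol {h : ℝ} (hh : 0 < h) (t : AddCircle (2 * Real.pi)) :
    ‖derivSymbol h t‖ = |angle t| / h := by
  simp [derivSymbol, abs_of_pos hh]

lemma norm_derivSymbol_le {h : ℝ} (hh : 0 < h) (t : AddCircle (2 * Real.pi)) :
    ‖derivSymbol h t‖ ≤ Real.pi / h := by
  rw [norm_derivSymbol hh]
  gcongr
  exact abs_angle_le t

lemma norm_diffSymbol {h : ℝ} (hh : 0 < h) (t : AddCircle (2 * Real.pi)) :
    ‖diffSymbol h t‖ = 2 * |Real.sin (angle t / 2)| / h := by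
  have := norm_exp_I_mul_ofReal_sub_one (-angle t)
  rw [diffSymbol, norm_div, show -(I * (angle t : ℂ)) = I * (-angle t : ℝ) by push_cast; ring, this]
  simp [abs_of_pos hh, neg_div]

lemma norm_diffSymbol_le {h : ℝ} (hh : 0 < h) (t : AddCircle (2 * Real.pi)) :
    ‖diffSymbol h t‖ ≤ ‖derivSymbol h t‖ := by
  rw [norm_diffSymbol hh, norm_derivSymbol hh]
  gcongr
  have := Real.abs_sin_le_abs (x := angle t / 2)
  rw [abs_div, abs_two] at this
  linarith

lemma mul_norm_derivSymbol_le {h : ℝ} (hh : 0 < h) (t : AddCircle (2 * Real.pi)) :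
    2 / Real.pi * ‖derivSymbol h t‖ ≤ ‖diffSymbol h t‖ := by
  rw [norm_diffSymbol hh, norm_derivSymbol hh, ← mul_div_assoc]
  refine div_le_div_of_nonneg_right ?_ hh.le
  have := Real.mul_abs_le_abs_sin (x := angle t / 2)
    (by rw [abs_div, abs_two]; linarith [abs_angle_le t])
  rw [abs_div, abs_two] at this
  linarith

lemma norm_exp_derivSymbol_mul (h x : ℝ) (t : AddCircle (2 * Real.pi)) :
    ‖exp (derivSymbol h t * x)‖ = 1 := by
  rw [derivSymbol, show -(I * angle t) / h * (x : ℂ) = (-(angle t) / h * x : ℝ) * I by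
    push_cast; ring, norm_exp_ofReal_mul_I]

/-- The `j`-th derivative of the band-limited function with spectral density `g`. -/
def synth (h : ℝ) (g : AddCircle (2 * Real.pi) → ℂ) (j : ℕ) (x : ℝ) : ℂ :=
  ∫ t, derivSymbol h t ^ j * exp (derivSymbol h t * x) * g t ∂circleMeasure

lemma hasDerivAt_pow_mul_exp_mul (c w : ℂ) (j : ℕ) (y : ℝ) :
    HasDerivAt (fun y : ℝ => c ^ j * exp (c * y) * w) (c ^ (j + 1) * exp (c * y) * w) y := by
  have h1 : HasDerivAt (fun y : ℝ => c * (y : ℂ)) c y := by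
    simpa using (hasDerivAt_id y).ofReal_comp.const_mul c
  refine ((h1.cexp.const_mul (c ^ j)).mul_const w).congr_deriv ?_
  ring

section synth

variable {h : ℝ} {g : AddCircle (2 * Real.pi) → ℂ}

lemma memLp_synth_integrand (hh : 0 < h) (hg : MemLp g 2 circleMeasure) (j : ℕ) (x : ℝ) :
    MemLp (fun t => derivSymbol h t ^ j * exp (derivSymbol h t * x) * g t) 2 circleMeasure := by
  refine memLp_mul_of_norm_le (C := (Real.pi / h) ^ j) hg (by fun_prop) fun t => ?_
  rw [norm_mul, norm_exp_derivSymbol_mul, norm_pow, mul_one]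
  gcongr
  exact norm_derivSymbol_le hh t

lemma hasDerivAt_synth (hh : 0 < h) (hg : MemLp g 2 circleMeasure) (j : ℕ) (x : ℝ) :
    HasDerivAt (synth h g j) (synth h g (j + 1) x) x := by
  refine (hasDerivAt_integral_of_dominated_loc_of_deriv_le (s := univ)
    (F := fun y t => derivSymbol h t ^ j * exp (derivSymbol h t * (y : ℝ)) * g t)
    (F' := fun y t => derivSymbol h t ^ (j + 1) * exp (derivSymbol h t * (y : ℝ)) * g t)
    (bound := fun t => (Real.pi / h) ^ (j + 1) * ‖g t‖) Filter.univ_mem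
    (.of_forall fun y => (memLp_synth_integrand hh hg j y).1)
    ((memLp_synth_integrand hh hg j x).integrable (by norm_num))
    (memLp_synth_integrand hh hg (j + 1) x).1 (.of_forall fun t y _ => ?_)
    ((hg.integrable (by norm_num)).norm.const_mul _) (.of_forall fun t y _ => ?_)).2
  · rw [norm_mul, norm_mul, norm_exp_derivSymbol_mul, norm_pow, mul_one]
    gcongr
    exact norm_derivSymbol_le hh t
  · exact hasDerivAt_pow_mul_exp_mul _ _ _ _

lemma fourierCoeff_synth_integrand (hh : 0 < h) (j : ℕ) (x : ℝ) (l : ℤ) :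
    fourierCoeff (fun t => derivSymbol h t ^ j * exp (derivSymbol h t * x) * g t) l
      = synth h g j (l * h + x) := by
  have hh' : (h : ℂ) ≠ 0 := by exact_mod_cast hh.ne'
  refine integral_congr_ae (.of_forall fun t => ?_)
  have : derivSymbol h t * ((l * h + x : ℝ) : ℂ)
      = I * angle t * ((-l : ℤ) : ℂ) + derivSymbol h t * x := by
    rw [derivSymbol]
    push_cast
    field_simp
    ring
  simp only [fourier_eq_exp_angle, smul_eq_mul, this, Complex.exp_add]
  ring

lemma synth_mesh_point (hh : 0 < h) (l : ℤ) : synth h g 0 (l * h) = fourierCoeff g l := by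
  simpa using (fourierCoeff_synth_integrand (g := g) hh 0 0 l).symm

lemma hasSum_sq_synth (hh : 0 < h) (hg : MemLp g 2 circleMeasure) (j : ℕ) (x : ℝ) :
    HasSum (fun l : ℤ => ‖synth h g j (l * h + x)‖ ^ 2)
      (∫ t, ‖derivSymbol h t ^ j * g t‖ ^ 2 ∂circleMeasure) := by
  convert (memLp_synth_integrand hh hg j x).hasSum_sq_fourierCoeff using 3
  · rw [fourierCoeff_synth_integrand hh]
  · simp [norm_exp_derivSymbol_mul]

lemma hasSum_sinc_mul_fourierCoeff (hh : 0 < h) (hg : MemLp g 2 circleMeasure) (x : ℝ) :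
    HasSum (fun l : ℤ => (sinc (Real.pi / h * (l * h - x)) : ℂ) * fourierCoeff g l)
      (synth h g 0 x) := by
  have hh' : (h : ℂ) ≠ 0 := by exact_mod_cast hh.ne'
  have hf : MemLp (fun t => exp (-(derivSymbol h t * x)) * 1) 2 circleMeasure := by
    refine memLp_mul_of_norm_le (C := 1) (memLp_const 1) (by fun_prop) fun t => ?_
    have := norm_exp_derivSymbol_mul h (-x) t
    rw [ofReal_neg, mul_neg] at this
    exact this.le
  have hconj (t : AddCircle (2 * Real.pi)) : starRingEnd ℂ (exp (-(derivSymbol h t * x)) * 1)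
      = exp (derivSymbol h t * x) := by
    rw [mul_one, ← exp_conj]
    congr 1
    simp [derivSymbol, neg_div]
  have hleft (l : ℤ) : inner ℂ (hf.toLp _) (fourierBasis (T := 2 * Real.pi) l)
      = (sinc (Real.pi / h * (l * h - x)) : ℂ) := by
    rw [L2.inner_def, coe_fourierBasis,
      show Real.pi / h * (l * h - x) = Real.pi * (l - x / h) by field_simp, ← integral_exp_angle]
    apply integral_congr_ae
    filter_upwards [coeFn_fourierLp 2 l, hf.coeFn_toLp] with t h1 h2
    rw [h1, h2, RCLike.inner_apply', hconj, fourier_eq_exp_angle, ← Complex.exp_add, derivSymbol]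
    congr 1
    push_cast
    field_simp
    ring
  have hright (l : ℤ) : inner ℂ (fourierBasis (T := 2 * Real.pi) l) (hg.toLp _)
      = fourierCoeff g l := by
    rw [← HilbertBasis.repr_apply_apply, fourierBasis_repr, fourierCoeff_congr_ae hg.coeFn_toLp]
  have hprod : inner ℂ (hf.toLp _) (hg.toLp _) = synth h g 0 x := by
    rw [L2.inner_def]
    apply integral_congr_ae
    filter_upwards [hg.coeFn_toLp, hf.coeFn_toLp] with t h1 h2
    rw [h1, h2, RCLike.inner_apply', hconj]
    simp
  simpa only [hleft, hright, hprod] using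
    (fourierBasis (T := 2 * Real.pi)).hasSum_inner_mul_inner (hf.toLp _) (hg.toLp _)

lemma memLp_diffSymbol_pow_mul (hh : 0 < h) (hg : MemLp g 2 circleMeasure) (j : ℕ) :
    MemLp (fun t => diffSymbol h t ^ j * g t) 2 circleMeasure := by
  refine memLp_mul_of_norm_le (C := (Real.pi / h) ^ j) hg (by fun_prop) fun t => ?_
  rw [norm_pow]
  gcongr
  exact (norm_diffSymbol_le hh t).trans (norm_derivSymbol_le hh t)

lemma fourierCoeff_diffSymbol_pow_succ_mul (hh : 0 < h) (hg : MemLp g 2 circleMeasure) (j : ℕ)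
    (l : ℤ) : fourierCoeff (fun t => diffSymbol h t ^ (j + 1) * g t) l
      = (h : ℂ)⁻¹ * (fourierCoeff (fun t => diffSymbol h t ^ j * g t) (l + 1)
        - fourierCoeff (fun t => diffSymbol h t ^ j * g t) l) := by
  have hint := (memLp_diffSymbol_pow_mul hh hg j).integrable (by norm_num)
  rw [fourierCoeff, fourierCoeff, fourierCoeff, ← integral_sub (hint.fourier_smul _)
    (hint.fourier_smul _), ← integral_const_mul]
  refine integral_congr_ae (.of_forall fun t => ?_)
  have : I * angle t * ((-(l + 1) : ℤ) : ℂ) = I * angle t * ((-l : ℤ) : ℂ) + -(I * angle t) := by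
    push_cast
    ring
  simp only [fourier_eq_exp_angle, smul_eq_mul, this, Complex.exp_add, pow_succ]
  rw [diffSymbol]
  ring

lemma integral_sq_diffSymbol_le (hh : 0 < h) (hg : MemLp g 2 circleMeasure) (j : ℕ) :
    ∫ t, ‖diffSymbol h t ^ j * g t‖ ^ 2 ∂circleMeasure
      ≤ ∫ t, ‖derivSymbol h t ^ j * g t‖ ^ 2 ∂circleMeasure := by
  have hd := memLp_synth_integrand hh hg j 0
  simp only [ofReal_zero, mul_zero, Complex.exp_zero, mul_one] at hd
  refine integral_mono (memLp_diffSymbol_pow_mul hh hg j).norm.integrable_sq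
    hd.norm.integrable_sq fun t => ?_
  simp only [norm_mul, norm_pow]
  gcongr
  exact norm_diffSymbol_le hh t

lemma integral_sq_derivSymbol_le (hh : 0 < h) (hg : MemLp g 2 circleMeasure) (j : ℕ) :
    ((2 / Real.pi) ^ j) ^ 2 * ∫ t, ‖derivSymbol h t ^ j * g t‖ ^ 2 ∂circleMeasure
      ≤ ∫ t, ‖diffSymbol h t ^ j * g t‖ ^ 2 ∂circleMeasure := by
  have hd := memLp_synth_integrand hh hg j 0
  simp only [ofReal_zero, mul_zero, Complex.exp_zero, mul_one] at hd
  rw [← integral_const_mul]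
  refine integral_mono (hd.norm.integrable_sq.const_mul _)
    (memLp_diffSymbol_pow_mul hh hg j).norm.integrable_sq fun t => ?_
  simp only [norm_mul, norm_pow]
  rw [← mul_pow, ← mul_assoc, ← mul_pow]
  gcongr
  exact mul_norm_derivSymbol_le hh t

end synth

/-- The `j`-th derivative of the vector-valued band-limited function whose components have the
spectral densities `g i`. -/
def vectorSynth (d : ℕ) (h : ℝ) (g : Fin d → AddCircle (2 * Real.pi) → ℂ) (j : ℕ) (x : ℝ) :
    EuclideanSpace ℝ (Fin d) :=
  WithLp.toLp 2 fun i => (synth h (g i) j x).re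

section vectorSynth

variable {d : ℕ} {h : ℝ} {u : ℤ → EuclideanSpace ℝ (Fin d)}
  {g : Fin d → AddCircle (2 * Real.pi) → ℂ}

lemma hasDerivAt_vectorSynth (hh : 0 < h) (hg : ∀ i, MemLp (g i) 2 circleMeasure) (j : ℕ) (x : ℝ) :
    HasDerivAt (vectorSynth d h g j) (vectorSynth d h g (j + 1) x) x := by
  have h1 : HasDerivAt (fun y i => (synth h (g i) j y).re)
      (fun i => (synth h (g i) (j + 1) x).re) x :=
    hasDerivAt_pi.2 fun i => reCLM.hasFDerivAt.comp_hasDerivAt x (hasDerivAt_synth hh (hg i) j x)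
  exact (EuclideanSpace.equiv (Fin d) ℝ).symm.toContinuousLinearMap.hasFDerivAt.comp_hasDerivAt x h1

lemma synth_im (hh : 0 < h) (hg : ∀ i, MemLp (g i) 2 circleMeasure)
    (hu : ∀ i l, fourierCoeff (g i) l = (u l i : ℂ)) (i : Fin d) (j : ℕ) (x : ℝ) :
    (synth h (g i) j x).im = 0 := by
  induction j generalizing x with
  | zero =>
    have := hasSum_im (hasSum_sinc_mul_fourierCoeff hh (hg i) x)
    simp only [hu, ← ofReal_mul, ofReal_im] at this
    exact this.unique hasSum_zero
  | succ j ih =>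
    have h1 := imCLM.hasFDerivAt.comp_hasDerivAt x (hasDerivAt_synth hh (hg i) j x)
    have h2 : imCLM ∘ synth h (g i) j = fun _ => 0 := funext ih
    rw [h2] at h1
    exact h1.unique (hasDerivAt_const x 0)

lemma hasSum_vectorSynth (hh : 0 < h) (hg : ∀ i, MemLp (g i) 2 circleMeasure)
    (hu : ∀ i l, fourierCoeff (g i) l = (u l i : ℂ)) (x : ℝ) :
    HasSum (fun l : ℤ => sinc (Real.pi / h * (l * h - x)) • u l) (vectorSynth d h g 0 x) := by
  refine (EuclideanSpace.equiv (Fin d) ℝ).hasSum'.1 (Pi.hasSum.2 fun i => ?_)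
  have := hasSum_re (hasSum_sinc_mul_fourierCoeff hh (hg i) x)
  simp only [hu, ← ofReal_mul, ofReal_re] at this
  exact this

lemma cardinal_eq_vectorSynth (hh : 0 < h) (hg : ∀ i, MemLp (g i) 2 circleMeasure)
    (hu : ∀ i l, fourierCoeff (g i) l = (u l i : ℂ)) : cardinal d h u = vectorSynth d h g 0 :=
  funext fun x => (hasSum_vectorSynth hh hg hu x).tsum_eq

lemma iteratedDeriv_cardinal (hh : 0 < h) (hg : ∀ i, MemLp (g i) 2 circleMeasure)
    (hu : ∀ i l, fourierCoeff (g i) l = (u l i : ℂ)) (j : ℕ) :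
    iteratedDeriv j (cardinal d h u) = vectorSynth d h g j := by
  induction j with
  | zero => rw [iteratedDeriv_zero, cardinal_eq_vectorSynth hh hg hu]
  | succ j ih =>
    rw [iteratedDeriv_succ, ih]
    exact funext fun x => (hasDerivAt_vectorSynth hh hg j x).deriv

lemma continuous_vectorSynth (hh : 0 < h) (hg : ∀ i, MemLp (g i) 2 circleMeasure) (j : ℕ) :
    Continuous (vectorSynth d h g j) :=
  continuous_iff_continuousAt.2 fun x => (hasDerivAt_vectorSynth hh hg j x).continuousAt

lemma integral_sq_vectorSynth (hh : 0 < h) (hg : ∀ i, MemLp (g i) 2 circleMeasure)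
    (hu : ∀ i l, fourierCoeff (g i) l = (u l i : ℂ)) (j : ℕ) :
    Integrable (fun x => ‖vectorSynth d h g j x‖ ^ 2) ∧ ∫ x, ‖vectorSynth d h g j x‖ ^ 2
      = (∑ i, ∫ t, ‖derivSymbol h t ^ j * g i t‖ ^ 2 ∂circleMeasure) * h := by
  refine integrable_and_integral_of_hasSum_translates hh
    ((continuous_vectorSynth hh hg j).norm.pow 2) (fun x => by positivity) fun x => ?_
  have hnorm (y : ℝ) : ‖vectorSynth d h g j y‖ ^ 2 = ∑ i, ‖synth h (g i) j y‖ ^ 2 := by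
    rw [EuclideanSpace.norm_sq_eq]
    refine Finset.sum_congr rfl fun i _ => ?_
    rw [Complex.sq_norm, normSq_apply, synth_im hh hg hu, vectorSynth, Real.norm_eq_abs, sq_abs]
    ring
  simp only [hnorm]
  exact hasSum_sum fun i _ => hasSum_sq_synth hh (hg i) j x

lemma iterate_DpV_apply (hh : 0 < h) (hg : ∀ i, MemLp (g i) 2 circleMeasure)
    (hu : ∀ i l, fourierCoeff (g i) l = (u l i : ℂ)) (i : Fin d) (j : ℕ) (l : ℤ) :
    (((DpV d h)^[j] u l i : ℝ) : ℂ) = fourierCoeff (fun t => diffSymbol h t ^ j * g i t) l := by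
  induction j generalizing l with
  | zero => simp [hu]
  | succ j ih =>
    rw [fourierCoeff_diffSymbol_pow_succ_mul hh (hg i), ← ih, ← ih, Function.iterate_succ_apply',
      DpV]
    simp

lemma tsum_sq_iterate_DpV (hh : 0 < h) (hg : ∀ i, MemLp (g i) 2 circleMeasure)
    (hu : ∀ i l, fourierCoeff (g i) l = (u l i : ℂ)) (j : ℕ) :
    ∑' l : ℤ, ‖(DpV d h)^[j] u l‖ ^ 2 * h
      = (∑ i, ∫ t, ‖diffSymbol h t ^ j * g i t‖ ^ 2 ∂circleMeasure) * h := by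
  have hnorm (l : ℤ) : ‖(DpV d h)^[j] u l‖ ^ 2
      = ∑ i, ‖fourierCoeff (fun t => diffSymbol h t ^ j * g i t) l‖ ^ 2 := by
    rw [EuclideanSpace.norm_sq_eq]
    refine Finset.sum_congr rfl fun i _ => ?_
    rw [← iterate_DpV_apply hh hg hu, norm_real]
  simp only [hnorm]
  exact ((hasSum_sum fun i _ =>
    (memLp_diffSymbol_pow_mul hh (hg i) j).hasSum_sq_fourierCoeff).mul_right h).tsum_eq

lemma exists_spectral_density (hu : Summable fun l => ‖u l‖ ^ 2) :
    ∃ g : Fin d → AddCircle (2 * Real.pi) → ℂ, (∀ i, MemLp (g i) 2 circleMeasure) ∧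
      ∀ i l, fourierCoeff (g i) l = (u l i : ℂ) := by
  have (i : Fin d) : ∃ f : AddCircle (2 * Real.pi) → ℂ, MemLp f 2 circleMeasure ∧
      fourierCoeff f = fun l => (u l i : ℂ) := by
    refine exists_memLp_fourierCoeff_eq (hu.of_nonneg_of_le (fun l => by positivity) fun l => ?_)
    rw [norm_real]
    gcongr
    exact PiLp.norm_apply_le (u l) i
  choose g hg hgu using this
  exact ⟨g, hg, fun i l => congrFun (hgu i) l⟩

end vectorSynth

end

/-- properties of the smoothing operator `I_h`:  `U = I_h u` is smooth,
interpolates `u` at the mesh points, `u ↦ U` is an isometry into `L²(ℝ)`, and the discrete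
derivatives of `u` are comparable with the `L²` norms of the derivatives of `U`. -/
theorem statement15 (d : ℕ) (h : ℝ) (hh : 0 < h)
    (u : ℤ → EuclideanSpace ℝ (Fin d))
    (hsum : Summable (fun l : ℤ => ‖u l‖ ^ 2 * h)) :
    (∀ n : ℕ, ContDiff ℝ n (cardinal d h u)) ∧
    (∀ l : ℤ, cardinal d h u ((l : ℝ) * h) = u l) ∧
    (Integrable (fun x : ℝ => ‖cardinal d h u x‖ ^ 2) ∧
      (∫ x : ℝ, ‖cardinal d h u x‖ ^ 2) = ∑' l : ℤ, ‖u l‖ ^ 2 * h) ∧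
    (∀ j : ℕ, 0 < j →
      Integrable (fun x : ℝ => ‖iteratedDeriv j (cardinal d h u) x‖ ^ 2) ∧
      (2 / Real.pi) ^ j * Real.sqrt (∫ x : ℝ, ‖iteratedDeriv j (cardinal d h u) x‖ ^ 2)
        ≤ Real.sqrt (∑' l : ℤ, ‖(DpV d h)^[j] u l‖ ^ 2 * h) ∧
      Real.sqrt (∑' l : ℤ, ‖(DpV d h)^[j] u l‖ ^ 2 * h)
        ≤ Real.sqrt (∫ x : ℝ, ‖iteratedDeriv j (cardinal d h u) x‖ ^ 2)) := by
  obtain ⟨g, hg, hu⟩ := exists_spectral_density ((summable_mul_right_iff hh.ne').1 hsum)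
  have hcard := cardinal_eq_vectorSynth hh hg hu
  refine ⟨fun n => contDiff_nat_iff_iteratedDeriv.2 ⟨fun m _ => ?_, fun m _ => ?_⟩, fun l => ?_,
    ?_, fun j _ => ?_⟩
  · rw [iteratedDeriv_cardinal hh hg hu]
    exact continuous_vectorSynth hh hg m
  · rw [iteratedDeriv_cardinal hh hg hu]
    exact fun x => (hasDerivAt_vectorSynth hh hg m x).differentiableAt
  · rw [hcard]
    ext i
    simp [vectorSynth, synth_mesh_point hh, hu]
  · rw [hcard]
    refine ⟨(integral_sq_vectorSynth hh hg hu 0).1, ?_⟩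
    have := tsum_sq_iterate_DpV hh hg hu 0
    simp only [Function.iterate_zero, id_eq, pow_zero, one_mul] at this
    rw [(integral_sq_vectorSynth hh hg hu 0).2, this]
    simp
  · rw [iteratedDeriv_cardinal hh hg hu]
    refine ⟨(integral_sq_vectorSynth hh hg hu j).1, ?_, ?_⟩
    · refine Real.le_sqrt_of_sq_le ?_
      rw [mul_pow, Real.sq_sqrt (integral_nonneg fun x => by positivity),
        (integral_sq_vectorSynth hh hg hu j).2, tsum_sq_iterate_DpV hh hg hu, ← mul_assoc,
        Finset.mul_sum]
      gcongr with i
      exact integral_sq_derivSymbol_le hh (hg i) j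
    · rw [(integral_sq_vectorSynth hh hg hu j).2, tsum_sq_iterate_DpV hh hg hu]
      exact Real.sqrt_le_sqrt (mul_le_mul_of_nonneg_right
        (Finset.sum_le_sum fun i _ => integral_sq_diffSymbol_le hh (hg i) j) hh.le)
end
end

section
/- Let μ ∈ {1, −1} and β ≤ 0. For any initial condition w₀ ∈ S^β(ℝ → ℂ) there exists an asymptotic solution f ∈ S^β(ℝ×ℝ → ℂ) of the initial value problem i∂_t w + ∂_x² w + μ|w|²w = 0, w(·,0) = w₀; that is, a function f ∈ S^β(ℝ×ℝ → ℂ) such that i∂_t f + ∂_x² f + μ|f|²f ∈ S^(−∞)(ℝ×ℝ → ℂ) and f(·,0) − w₀ ∈ S^(−∞)(ℝ → ℂ). Moreover, if w₀ has asymptotic expansions with coefficients a_k^± + i b_k^± and exponents β_k at ±∞, and j is the smallest index such that a_j^+ + i b_j^+ ≠ 0 (respectively a_j^− + i b_j^− ≠ 0), then the coefficient a_j^+(t) + i b_j^+(t) (respectively a_j^−(t) + i b_j^−(t)) in the asymptotic expansion of f is a nonvanishing continuous function of t on ℝ, and all coefficients with index less than j are identically zero. -/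
noncomputable section

/-- The Japanese bracket `⟨x⟩ = √(x² + 1)`. -/
def jb (x : ℝ) : ℝ := Real.sqrt (x ^ 2 + 1)

/-- Mixed partial derivative `∂_t^i ∂_x^j u (x, t)`. -/
def pd (u : ℝ → ℝ → ℂ) (i j : ℕ) (x t : ℝ) : ℂ :=
  iteratedDeriv i (fun s => iteratedDeriv j (fun y => u y s) x) t

/-- Joint smoothness (`C^∞`) of a function of two real variables. -/
def Smooth2 (u : ℝ → ℝ → ℂ) : Prop := ∀ n : ℕ, ContDiff ℝ n (Function.uncurry u)

/-- A valid sequence of exponents for the space `S^β`: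
`β = β₀ > β₁ > β₂ > ⋯` with `β_k → −∞`. -/
def IsExp (β : ℝ) (e : ℕ → ℝ) : Prop :=
  e 0 = β ∧ StrictAnti e ∧ Filter.Tendsto e Filter.atTop Filter.atBot

/-- Partial sum `Σ_{k=0}^N (a_k(t) + i b_k(t)) x^{β_k}` of an asymptotic expansion at `+∞`. -/
def psumP (e : ℕ → ℝ) (a b : ℕ → ℝ → ℝ) (N : ℕ) (x t : ℝ) : ℂ :=
  ∑ k ∈ Finset.range (N + 1), ((a k t : ℂ) + Complex.I * (b k t : ℂ)) * ((x ^ e k : ℝ) : ℂ)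

/-- Partial sum `Σ_{k=0}^N (a_k(t) + i b_k(t)) (−x)^{β_k}` of an asymptotic expansion at `−∞`. -/
def psumM (e : ℕ → ℝ) (a b : ℕ → ℝ → ℝ) (N : ℕ) (x t : ℝ) : ℂ :=
  ∑ k ∈ Finset.range (N + 1), ((a k t : ℂ) + Complex.I * (b k t : ℂ)) * (((-x) ^ e k : ℝ) : ℂ)

/-- `w` is asymptotic, locally uniformly in time `t ∈ ℝ`, to the expansions at `±∞` with
exponents `e` and coefficients `ap + i bp` (at `+∞`) and `am + i bm` (at `−∞`). -/
def AsymR (w : ℝ → ℝ → ℂ) (e : ℕ → ℝ) (ap bp am bm : ℕ → ℝ → ℝ) : Prop :=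
  (∀ R > (0 : ℝ), ∀ N i j : ℕ, ∃ C > (0 : ℝ), ∀ x : ℝ, 1 ≤ x → ∀ t ∈ Set.Icc (-R) R,
    ‖pd (fun y s => w y s - psumP e ap bp N y s) i j x t‖ ≤ C * x ^ (e (N + 1) - (j : ℝ))) ∧
  (∀ R > (0 : ℝ), ∀ N i j : ℕ, ∃ C > (0 : ℝ), ∀ x : ℝ, x ≤ -1 → ∀ t ∈ Set.Icc (-R) R,
    ‖pd (fun y s => w y s - psumM e am bm N y s) i j x t‖ ≤ C * (-x) ^ (e (N + 1) - (j : ℝ)))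

/-- Membership in `S^{-∞}(ℝ × ℝ → ℂ)`. -/
def SMinusInfR (u : ℝ → ℝ → ℂ) : Prop :=
  Smooth2 u ∧ ∀ R > (0 : ℝ), ∀ N i j : ℕ, ∃ C > (0 : ℝ), ∀ x : ℝ, ∀ t ∈ Set.Icc (-R) R,
    ‖pd u i j x t‖ ≤ C * jb x ^ (-(N : ℝ))

open scoped ContDiff
open Set

/-- Partial derivative in the space variable. -/
def dX (u : ℝ → ℝ → ℂ) : ℝ → ℝ → ℂ := fun x t => deriv (fun y => u y t) x

/-- Partial derivative in the time variable. -/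
def dT (u : ℝ → ℝ → ℂ) : ℝ → ℝ → ℂ := fun x t => deriv (fun s => u x s) t

/-- Joint smoothness on the strip `s × ℝ`. -/
def SmoothIn (s : Set ℝ) (u : ℝ → ℝ → ℂ) : Prop :=
  ContDiffOn ℝ ∞ (Function.uncurry u) (s ×ˢ univ)

section Smooth

variable {s : Set ℝ} {u v : ℝ → ℝ → ℂ}

theorem smoothIn_univ : SmoothIn univ u ↔ Smooth2 u := by
  rw [SmoothIn, univ_prod_univ, contDiffOn_univ, contDiff_infty]
  rfl

theorem SmoothIn.mono {s' : Set ℝ} (h : SmoothIn s u) (hs : s' ⊆ s) : SmoothIn s' u :=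
  ContDiffOn.mono h (prod_mono hs subset_rfl)

theorem Smooth2.smoothIn (h : Smooth2 u) (s : Set ℝ) : SmoothIn s u :=
  (smoothIn_univ.2 h).mono (subset_univ s)

theorem SmoothIn.add (hu : SmoothIn s u) (hv : SmoothIn s v) :
    SmoothIn s (fun x t => u x t + v x t) :=
  ContDiffOn.add hu hv

theorem SmoothIn.sub (hu : SmoothIn s u) (hv : SmoothIn s v) :
    SmoothIn s (fun x t => u x t - v x t) :=
  ContDiffOn.sub hu hv

theorem SmoothIn.mul (hu : SmoothIn s u) (hv : SmoothIn s v) :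
    SmoothIn s (fun x t => u x t * v x t) :=
  ContDiffOn.mul hu hv

theorem SmoothIn.conj (hu : SmoothIn s u) :
    SmoothIn s (fun x t => (starRingEnd ℂ) (u x t)) :=
  Complex.conjCLE.contDiff.comp_contDiffOn hu

theorem SmoothIn.sum {ι : Type*} {I : Finset ι} {w : ι → ℝ → ℝ → ℂ}
    (h : ∀ i ∈ I, SmoothIn s (w i)) : SmoothIn s (fun x t => ∑ i ∈ I, w i x t) := by
  have := ContDiffOn.sum (𝕜 := ℝ) (n := ∞) (f := fun i => Function.uncurry (w i)) (t := s ×ˢ univ) h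
  exact this

theorem smoothIn_const (c : ℂ) : SmoothIn s (fun _ _ => c) := contDiffOn_const

theorem smoothIn_time {c : ℝ → ℂ} (hc : ContDiff ℝ ∞ c) : SmoothIn s (fun _ t => c t) :=
  (hc.comp contDiff_snd).contDiffOn

theorem smoothIn_space {h : ℝ → ℂ} (hh : ContDiffOn ℝ ∞ h s) : SmoothIn s (fun x _ => h x) :=
  hh.comp contDiff_fst.contDiffOn fun _ hp => hp.1

theorem SmoothIn.congr (hu : SmoothIn s u) (h : ∀ x ∈ s, ∀ t, v x t = u x t) : SmoothIn s v :=
  ContDiffOn.congr hu fun p hp => h p.1 hp.1 p.2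

theorem SmoothIn.contDiffAt (hs : IsOpen s) (hu : SmoothIn s u) {x : ℝ} (hx : x ∈ s) (t : ℝ) :
    ContDiffAt ℝ ∞ (Function.uncurry u) (x, t) :=
  ContDiffOn.contDiffAt hu ((hs.prod isOpen_univ).mem_nhds ⟨hx, trivial⟩)

theorem SmoothIn.contDiffAt_left (hs : IsOpen s) (hu : SmoothIn s u) {x : ℝ} (hx : x ∈ s)
    (t : ℝ) : ContDiffAt ℝ ∞ (fun y => u y t) x :=
  ContDiffAt.comp x (f := fun y : ℝ => (y, t)) (hu.contDiffAt hs hx t)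
    (contDiffAt_id.prodMk contDiffAt_const)

theorem SmoothIn.contDiffAt_right (hs : IsOpen s) (hu : SmoothIn s u) {x : ℝ} (hx : x ∈ s)
    (t : ℝ) : ContDiffAt ℝ ∞ (fun r => u x r) t :=
  ContDiffAt.comp t (f := fun r : ℝ => (x, r)) (hu.contDiffAt hs hx t)
    (contDiffAt_const.prodMk contDiffAt_id)

theorem SmoothIn.differentiableAt_left (hs : IsOpen s) (hu : SmoothIn s u) {x : ℝ} (hx : x ∈ s)
    (t : ℝ) : DifferentiableAt ℝ (fun y => u y t) x :=
  (hu.contDiffAt_left hs hx t).differentiableAt (by simp)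

theorem SmoothIn.differentiableAt_right (hs : IsOpen s) (hu : SmoothIn s u) {x : ℝ} (hx : x ∈ s)
    (t : ℝ) : DifferentiableAt ℝ (fun r => u x r) t :=
  (hu.contDiffAt_right hs hx t).differentiableAt (by simp)

theorem SmoothIn.dX (hs : IsOpen s) (hu : SmoothIn s u) : SmoothIn s (dX u) := by
  have h := (ContDiffOn.fderiv_of_isOpen (m := ∞) hu (hs.prod isOpen_univ) (by simp)).clm_apply
    (contDiffOn_const (c := ((1, 0) : ℝ × ℝ)))
  refine ContDiffOn.congr h ?_
  rintro ⟨x, t⟩ ⟨hx, -⟩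
  have h1 := ((hu.contDiffAt hs hx t).differentiableAt (by simp)).hasFDerivAt
  exact (h1.comp_hasDerivAt x ((hasDerivAt_id x).prodMk (hasDerivAt_const x t))).deriv

theorem SmoothIn.dT (hs : IsOpen s) (hu : SmoothIn s u) : SmoothIn s (dT u) := by
  have h := (ContDiffOn.fderiv_of_isOpen (m := ∞) hu (hs.prod isOpen_univ) (by simp)).clm_apply
    (contDiffOn_const (c := ((0, 1) : ℝ × ℝ)))
  refine ContDiffOn.congr h ?_
  rintro ⟨x, t⟩ ⟨hx, -⟩
  have h1 := ((hu.contDiffAt hs hx t).differentiableAt (by simp)).hasFDerivAt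
  exact (h1.comp_hasDerivAt t ((hasDerivAt_const t x).prodMk (hasDerivAt_id t))).deriv

theorem SmoothIn.iterate_dX (hs : IsOpen s) (hu : SmoothIn s u) (j : ℕ) :
    SmoothIn s (_root_.dX^[j] u) := by
  induction j with
  | zero => exact hu
  | succ j ih => rw [Function.iterate_succ_apply']; exact ih.dX hs

theorem SmoothIn.iterate_dT (hs : IsOpen s) (hu : SmoothIn s u) (i : ℕ) :
    SmoothIn s (_root_.dT^[i] u) := by
  induction i with
  | zero => exact hu
  | succ i ih => rw [Function.iterate_succ_apply']; exact ih.dT hs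

theorem dX_congr (hs : IsOpen s) (h : ∀ x ∈ s, ∀ t, u x t = v x t) :
    ∀ x ∈ s, ∀ t, dX u x t = dX v x t := fun _ hx t =>
  Filter.EventuallyEq.deriv_eq (Filter.mem_of_superset (hs.mem_nhds hx) fun y hy => h y hy t)

theorem dT_congr (h : ∀ x ∈ s, ∀ t, u x t = v x t) :
    ∀ x ∈ s, ∀ t, dT u x t = dT v x t := fun _ hx _ => by
  rw [dT, dT, funext (h _ hx)]

theorem dT_iterate_apply (i : ℕ) (u : ℝ → ℝ → ℂ) (x t : ℝ) :
    (dT^[i] u) x t = deriv^[i] (u x) t := by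
  induction i generalizing u with
  | zero => rfl
  | succ i ih => rw [Function.iterate_succ_apply, Function.iterate_succ_apply, ih]; rfl

theorem dX_iterate_apply (j : ℕ) (u : ℝ → ℝ → ℂ) (x t : ℝ) :
    (dX^[j] u) x t = deriv^[j] (fun y => u y t) x := by
  induction j generalizing u with
  | zero => rfl
  | succ j ih => rw [Function.iterate_succ_apply, Function.iterate_succ_apply, ih]; rfl

theorem pd_eq_iterate (u : ℝ → ℝ → ℂ) (i j : ℕ) : pd u i j = dT^[i] (dX^[j] u) := by
  funext x t
  rw [pd, dT_iterate_apply, iteratedDeriv_eq_iterate]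
  refine congrArg (fun g : ℝ → ℂ => deriv^[i] g t) (funext fun r => ?_)
  rw [dX_iterate_apply, iteratedDeriv_eq_iterate]

theorem Smooth2.pd (h : Smooth2 u) (i j : ℕ) : Smooth2 (pd u i j) := by
  rw [pd_eq_iterate]
  exact smoothIn_univ.1
    (((smoothIn_univ.2 h).iterate_dX isOpen_univ j).iterate_dT isOpen_univ i)

end Smooth

/-- Quantitative symbol bounds of order `γ` for all partial derivatives of total order at most `n`,
on the part of `s × [-R, R]` where `x ≥ 1`. -/
def SymB (s : Set ℝ) (R C : ℝ) : ℕ → ℝ → (ℝ → ℝ → ℂ) → Prop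
  | 0, γ, u => ∀ x ∈ s, 1 ≤ x → ∀ t ∈ Icc (-R) R, ‖u x t‖ ≤ C * x ^ γ
  | n + 1, γ, u => (∀ x ∈ s, 1 ≤ x → ∀ t ∈ Icc (-R) R, ‖u x t‖ ≤ C * x ^ γ) ∧
      SymB s R C n (γ - 1) (dX u) ∧ SymB s R C n γ (dT u)

section SymB

variable {s : Set ℝ} {R C C' γ δ : ℝ} {n : ℕ} {u v : ℝ → ℝ → ℂ}

theorem SymB.bound (h : SymB s R C n γ u) :
    ∀ x ∈ s, 1 ≤ x → ∀ t ∈ Icc (-R) R, ‖u x t‖ ≤ C * x ^ γ := by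
  cases n with
  | zero => exact h
  | succ n => exact h.1

theorem SymB.congr (hs : IsOpen s) (h : SymB s R C n γ u) (huv : ∀ x ∈ s, ∀ t, v x t = u x t) :
    SymB s R C n γ v := by
  induction n generalizing u v γ with
  | zero => intro x hx h1 t ht; rw [huv x hx]; exact h x hx h1 t ht
  | succ n ih =>
    refine ⟨fun x hx h1 t ht => ?_, ih h.2.1 (dX_congr hs huv), ih h.2.2 (dT_congr huv)⟩
    rw [huv x hx]; exact h.1 x hx h1 t ht

theorem SymB.mono_const (h : SymB s R C n γ u) (hC : C ≤ C') : SymB s R C' n γ u := by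
  have key : ∀ {γ : ℝ} {u : ℝ → ℝ → ℂ}, (∀ x ∈ s, 1 ≤ x → ∀ t ∈ Icc (-R) R, ‖u x t‖ ≤ C * x ^ γ) →
      ∀ x ∈ s, 1 ≤ x → ∀ t ∈ Icc (-R) R, ‖u x t‖ ≤ C' * x ^ γ := fun h x hx h1 t ht =>
    (h x hx h1 t ht).trans
      (mul_le_mul_of_nonneg_right hC (Real.rpow_nonneg (by linarith) _))
  induction n generalizing u γ with
  | zero => exact key h
  | succ n ih => exact ⟨key h.1, ih h.2.1, ih h.2.2⟩

theorem SymB.mono_order (h : SymB s R C n γ u) (hC : 0 ≤ C) (hγ : γ ≤ δ) : SymB s R C n δ u := by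
  have key : ∀ {γ δ : ℝ} {u : ℝ → ℝ → ℂ}, γ ≤ δ →
      (∀ x ∈ s, 1 ≤ x → ∀ t ∈ Icc (-R) R, ‖u x t‖ ≤ C * x ^ γ) →
      ∀ x ∈ s, 1 ≤ x → ∀ t ∈ Icc (-R) R, ‖u x t‖ ≤ C * x ^ δ := fun hγ h x hx h1 t ht =>
    (h x hx h1 t ht).trans
      (mul_le_mul_of_nonneg_left (Real.rpow_le_rpow_of_exponent_le h1 hγ) hC)
  induction n generalizing u γ δ with
  | zero => exact key hγ h
  | succ n ih => exact ⟨key hγ h.1, ih h.2.1 (by linarith), ih h.2.2 hγ⟩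

theorem SymB.mono_time {R' : ℝ} (h : SymB s R C n γ u) (hR : R' ≤ R) : SymB s R' C n γ u := by
  have key : Icc (-R') R' ⊆ Icc (-R) R := Icc_subset_Icc (by linarith) hR
  induction n generalizing u γ with
  | zero => exact fun x hx h1 t ht => h x hx h1 t (key ht)
  | succ n ih => exact ⟨fun x hx h1 t ht => h.1 x hx h1 t (key ht), ih h.2.1, ih h.2.2⟩

theorem SymB.mono_set {s' : Set ℝ} (h : SymB s R C n γ u) (hs : s' ⊆ s) : SymB s' R C n γ u := by
  induction n generalizing u γ with
  | zero => exact fun x hx h1 t ht => h x (hs hx) h1 t ht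
  | succ n ih => exact ⟨fun x hx h1 t ht => h.1 x (hs hx) h1 t ht, ih h.2.1, ih h.2.2⟩

theorem SymB.pred (h : SymB s R C (n + 1) γ u) : SymB s R C n γ u := by
  induction n generalizing u γ with
  | zero => exact h.1
  | succ n ih => exact ⟨h.1, ih h.2.1, ih h.2.2⟩

theorem SymB.mono_nat {m : ℕ} (h : SymB s R C n γ u) (hm : m ≤ n) : SymB s R C m γ u := by
  induction n, hm using Nat.le_induction with
  | base => exact h
  | succ n _ ih => exact ih h.pred

theorem symB_zero (hC : 0 ≤ C) : SymB s R C n γ (fun _ _ => 0) := by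
  have key : ∀ γ : ℝ, ∀ x ∈ s, 1 ≤ x → ∀ t ∈ Icc (-R) R, ‖(0 : ℂ)‖ ≤ C * x ^ γ :=
    fun γ x _ h1 t _ => by
      rw [norm_zero]; exact mul_nonneg hC (Real.rpow_nonneg (by linarith) _)
  induction n generalizing γ with
  | zero => exact key γ
  | succ n ih =>
    have hX : dX (fun _ _ => 0) = fun _ _ => 0 := by funext x t; simp [dX]
    have hT : dT (fun _ _ => 0) = fun _ _ => 0 := by funext x t; simp [dT]
    exact ⟨key γ, by rw [hX]; exact ih, by rw [hT]; exact ih⟩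

theorem SymB.add (hs : IsOpen s) (hu : SmoothIn s u) (hv : SmoothIn s v)
    (h : SymB s R C n γ u) (h' : SymB s R C' n γ v) :
    SymB s R (C + C') n γ (fun x t => u x t + v x t) := by
  have key : ∀ {γ : ℝ} {u v : ℝ → ℝ → ℂ}, (∀ x ∈ s, 1 ≤ x → ∀ t ∈ Icc (-R) R, ‖u x t‖ ≤ C * x ^ γ) →
      (∀ x ∈ s, 1 ≤ x → ∀ t ∈ Icc (-R) R, ‖v x t‖ ≤ C' * x ^ γ) →
      ∀ x ∈ s, 1 ≤ x → ∀ t ∈ Icc (-R) R, ‖u x t + v x t‖ ≤ (C + C') * x ^ γ :=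
    fun h h' x hx h1 t ht => by
      rw [add_mul]
      exact (norm_add_le _ _).trans (add_le_add (h x hx h1 t ht) (h' x hx h1 t ht))
  induction n generalizing u v γ with
  | zero => exact key h h'
  | succ n ih =>
    refine ⟨key h.1 h'.1, (ih (hu.dX hs) (hv.dX hs) h.2.1 h'.2.1).congr hs fun x hx t => ?_,
      (ih (hu.dT hs) (hv.dT hs) h.2.2 h'.2.2).congr hs fun x hx t => ?_⟩
    · exact deriv_fun_add (hu.differentiableAt_left hs hx t) (hv.differentiableAt_left hs hx t)
    · exact deriv_fun_add (hu.differentiableAt_right hs hx t) (hv.differentiableAt_right hs hx t)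

theorem SymB.sum (hs : IsOpen s) {ι : Type*} {I : Finset ι} {w : ι → ℝ → ℝ → ℂ} {K : ι → ℝ}
    (hw : ∀ i ∈ I, SmoothIn s (w i)) (h : ∀ i ∈ I, SymB s R (K i) n γ (w i)) :
    SymB s R (∑ i ∈ I, K i) n γ (fun x t => ∑ i ∈ I, w i x t) := by
  classical
  induction I using Finset.induction_on with
  | empty => simpa using symB_zero le_rfl
  | insert a I ha ih =>
    simp only [Finset.sum_insert ha]
    exact SymB.add hs (hw a (by simp)) (SmoothIn.sum fun i hi => hw i (by simp [hi]))
      (h a (by simp)) (ih (fun i hi => hw i (by simp [hi])) fun i hi => h i (by simp [hi]))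

theorem SymB.conj (hs : IsOpen s) (h : SymB s R C n γ u) :
    SymB s R C n γ (fun x t => (starRingEnd ℂ) (u x t)) := by
  induction n generalizing u γ with
  | zero => intro x hx h1 t ht; rw [RCLike.norm_conj]; exact h x hx h1 t ht
  | succ n ih =>
    refine ⟨fun x hx h1 t ht => ?_, (ih h.2.1).congr hs fun x hx t => ?_,
      (ih h.2.2).congr hs fun x hx t => ?_⟩
    · rw [RCLike.norm_conj]; exact h.1 x hx h1 t ht
    · exact deriv.star (f := fun y => u y t)
    · exact deriv.star (f := fun r => u x r)

theorem SymB.mul (hs : IsOpen s) (hu : SmoothIn s u) (hv : SmoothIn s v) (hC : 0 ≤ C)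
    (hC' : 0 ≤ C') (h : SymB s R C n γ u) (h' : SymB s R C' n δ v) :
    SymB s R (2 ^ n * (C * C')) n (γ + δ) (fun x t => u x t * v x t) := by
  have key : ∀ {γ δ : ℝ} {u v : ℝ → ℝ → ℂ},
      (∀ x ∈ s, 1 ≤ x → ∀ t ∈ Icc (-R) R, ‖u x t‖ ≤ C * x ^ γ) →
      (∀ x ∈ s, 1 ≤ x → ∀ t ∈ Icc (-R) R, ‖v x t‖ ≤ C' * x ^ δ) →
      ∀ x ∈ s, 1 ≤ x → ∀ t ∈ Icc (-R) R, ‖u x t * v x t‖ ≤ (C * C') * x ^ (γ + δ) :=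
    fun {γ δ u v} h h' x hx h1 t ht => by
      have hx0 : 0 < x := by linarith
      rw [norm_mul, Real.rpow_add hx0]
      calc ‖u x t‖ * ‖v x t‖ ≤ (C * x ^ γ) * (C' * x ^ δ) :=
            mul_le_mul (h x hx h1 t ht) (h' x hx h1 t ht) (norm_nonneg _) (by positivity)
        _ = _ := by ring
  induction n generalizing u v γ δ with
  | zero => simpa [SymB] using key h h'
  | succ n ih =>
    have e2 : (2 : ℝ) ^ (n + 1) * (C * C') = 2 ^ n * (C * C') + 2 ^ n * (C * C') := by ring
    refine ⟨fun x hx h1 t ht => (key h.1 h'.1 x hx h1 t ht).trans ?_, ?_, ?_⟩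
    · refine mul_le_mul_of_nonneg_right ?_ (Real.rpow_nonneg (by linarith) _)
      exact le_mul_of_one_le_left (mul_nonneg hC hC') (one_le_pow₀ (by norm_num))
    · have h1 := ih (hu.dX hs) hv h.2.1 h'.pred
      have h2 := ih hu (hv.dX hs) h.pred h'.2.1
      rw [show γ - 1 + δ = γ + δ - 1 by ring] at h1
      rw [show γ + (δ - 1) = γ + δ - 1 by ring] at h2
      rw [e2]
      refine (SymB.add hs ((hu.dX hs).mul hv) (hu.mul (hv.dX hs)) h1 h2).congr hs
        fun x hx t => ?_
      exact deriv_fun_mul (hu.differentiableAt_left hs hx t) (hv.differentiableAt_left hs hx t)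
    · have h1 := ih (hu.dT hs) hv h.2.2 h'.pred
      have h2 := ih hu (hv.dT hs) h.pred h'.2.2
      rw [e2]
      refine (SymB.add hs ((hu.dT hs).mul hv) (hu.mul (hv.dT hs)) h1 h2).congr hs
        fun x hx t => ?_
      exact deriv_fun_mul (hu.differentiableAt_right hs hx t) (hv.differentiableAt_right hs hx t)

theorem SymB.of_vanish {ρ : ℝ} (hρ : 0 < ρ) (hC : 0 ≤ C) (hγ : γ ≤ δ)
    (h : SymB s R C n γ u) (h0 : ∀ x < ρ, ∀ t, u x t = 0) :
    SymB s R (C * ρ ^ (γ - δ)) n δ u := by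
  have key : ∀ {γ δ : ℝ} {u : ℝ → ℝ → ℂ}, γ ≤ δ → (∀ x < ρ, ∀ t, u x t = 0) →
      (∀ x ∈ s, 1 ≤ x → ∀ t ∈ Icc (-R) R, ‖u x t‖ ≤ C * x ^ γ) →
      ∀ x ∈ s, 1 ≤ x → ∀ t ∈ Icc (-R) R, ‖u x t‖ ≤ (C * ρ ^ (γ - δ)) * x ^ δ :=
    fun {γ δ u} hγ h0 h x hx h1 t ht => by
      have hx0 : 0 < x := by linarith
      rcases lt_or_ge x ρ with hxρ | hxρ
      · rw [h0 x hxρ, norm_zero]; positivity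
      · refine (h x hx h1 t ht).trans ?_
        have : x ^ (γ - δ) ≤ ρ ^ (γ - δ) :=
          Real.rpow_le_rpow_of_nonpos hρ hxρ (by linarith)
        calc C * x ^ γ = C * (x ^ (γ - δ) * x ^ δ) := by
              rw [← Real.rpow_add hx0]; congr 2; ring
          _ ≤ C * (ρ ^ (γ - δ) * x ^ δ) := by gcongr
          _ = _ := by ring
  induction n generalizing u γ δ with
  | zero => exact key hγ h0 h
  | succ n ih =>
    have hX := dX_congr (s := Iio ρ) (v := fun _ _ => 0) isOpen_Iio h0
    have hT := dT_congr (s := Iio ρ) (v := fun _ _ => 0) h0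
    refine ⟨key hγ h0 h.1, ?_, ?_⟩
    · have := ih (δ := δ - 1) (by linarith) h.2.1 fun x hx t => by rw [hX x hx t]; simp [dX]
      rwa [show γ - 1 - (δ - 1) = γ - δ by ring] at this
    · exact ih hγ h.2.2 fun x hx t => by rw [hT x hx t]; simp [dT]

theorem SymB.of_forall_Ioo (h : ∀ X : ℝ, SymB (Ioo 0 X) R C n γ u) :
    SymB (Ioi 0) R C n γ u := by
  induction n generalizing u γ with
  | zero => exact fun x hx h1 t ht => h (x + 1) x ⟨hx, by linarith⟩ h1 t ht
  | succ n ih =>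
    exact ⟨fun x hx h1 t ht => (h (x + 1)).1 x ⟨hx, by linarith⟩ h1 t ht,
      ih fun X => (h X).2.1, ih fun X => (h X).2.2⟩

theorem SymB.iterate_dX (j : ℕ) (h : SymB s R C (n + j) γ u) : SymB s R C n (γ - j) (dX^[j] u) := by
  induction j generalizing u γ with
  | zero => simpa using h
  | succ j ih =>
    have := ih (u := dX u) (γ := γ - 1) h.2.1
    rw [Function.iterate_succ_apply]
    rwa [Nat.cast_succ, add_comm (j : ℝ) 1, ← sub_sub]

theorem SymB.iterate_dT (i : ℕ) (h : SymB s R C (n + i) γ u) : SymB s R C n γ (dT^[i] u) := by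
  induction i generalizing u with
  | zero => exact h
  | succ i ih => rw [Function.iterate_succ_apply]; exact ih h.2.2

end SymB

/-- Smooth functions on the right half-plane that are symbols of order `γ` as `x → ∞`. -/
def SymClass (γ : ℝ) (u : ℝ → ℝ → ℂ) : Prop :=
  SmoothIn (Ioi 0) u ∧ ∀ (n : ℕ) (R : ℝ), ∃ C, 0 ≤ C ∧ SymB (Ioi 0) R C n γ u

section SymClass

variable {γ δ : ℝ} {u v : ℝ → ℝ → ℂ}

theorem exists_symB_succ {s : Set ℝ} {R C : ℝ} {n : ℕ} (hC : 0 ≤ C)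
    (h : ∀ x ∈ s, 1 ≤ x → ∀ t ∈ Icc (-R) R, ‖u x t‖ ≤ C * x ^ γ)
    (hX : ∃ C, 0 ≤ C ∧ SymB s R C n (γ - 1) (dX u)) (hT : ∃ C, 0 ≤ C ∧ SymB s R C n γ (dT u)) :
    ∃ C, 0 ≤ C ∧ SymB s R C (n + 1) γ u := by
  obtain ⟨C1, h1, hX⟩ := hX
  obtain ⟨C2, h2, hT⟩ := hT
  refine ⟨C + C1 + C2, by positivity, fun x hx hx1 t ht => (h x hx hx1 t ht).trans ?_,
    hX.mono_const (by linarith), hT.mono_const (by linarith)⟩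
  exact mul_le_mul_of_nonneg_right (by linarith) (Real.rpow_nonneg (by linarith) _)

theorem SymClass.mono (h : SymClass γ u) (hγ : γ ≤ δ) : SymClass δ u :=
  ⟨h.1, fun n R => let ⟨C, hC, hu⟩ := h.2 n R; ⟨C, hC, hu.mono_order hC hγ⟩⟩

theorem SymClass.congr (h : SymClass γ u) (huv : ∀ x, 0 < x → ∀ t, v x t = u x t) : SymClass γ v :=
  ⟨h.1.congr huv, fun n R => let ⟨C, hC, hu⟩ := h.2 n R; ⟨C, hC, hu.congr isOpen_Ioi huv⟩⟩

theorem symClass_zero : SymClass γ (fun _ _ => 0) :=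
  ⟨smoothIn_const 0, fun _ _ => ⟨0, le_rfl, symB_zero le_rfl⟩⟩

theorem SymClass.add (hu : SymClass γ u) (hv : SymClass γ v) :
    SymClass γ (fun x t => u x t + v x t) :=
  ⟨hu.1.add hv.1, fun n R => by
    obtain ⟨C, hC, h⟩ := hu.2 n R
    obtain ⟨C', hC', h'⟩ := hv.2 n R
    exact ⟨C + C', by positivity, SymB.add isOpen_Ioi hu.1 hv.1 h h'⟩⟩

theorem SymClass.mul (hu : SymClass γ u) (hv : SymClass δ v) :
    SymClass (γ + δ) (fun x t => u x t * v x t) :=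
  ⟨hu.1.mul hv.1, fun n R => by
    obtain ⟨C, hC, h⟩ := hu.2 n R
    obtain ⟨C', hC', h'⟩ := hv.2 n R
    exact ⟨2 ^ n * (C * C'), by positivity, SymB.mul isOpen_Ioi hu.1 hv.1 hC hC' h h'⟩⟩

theorem SymClass.conj (hu : SymClass γ u) : SymClass γ (fun x t => (starRingEnd ℂ) (u x t)) :=
  ⟨hu.1.conj, fun n R => let ⟨C, hC, h⟩ := hu.2 n R; ⟨C, hC, SymB.conj isOpen_Ioi h⟩⟩

theorem SymClass.dX (hu : SymClass γ u) : SymClass (γ - 1) (dX u) :=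
  ⟨hu.1.dX isOpen_Ioi, fun n R => let ⟨C, hC, h⟩ := hu.2 (n + 1) R; ⟨C, hC, h.2.1⟩⟩

theorem SymClass.dT (hu : SymClass γ u) : SymClass γ (dT u) :=
  ⟨hu.1.dT isOpen_Ioi, fun n R => let ⟨C, hC, h⟩ := hu.2 (n + 1) R; ⟨C, hC, h.2.2⟩⟩

theorem SymClass.sum {ι : Type*} {I : Finset ι} {w : ι → ℝ → ℝ → ℂ} (h : ∀ i ∈ I, SymClass γ (w i)) :
    SymClass γ (fun x t => ∑ i ∈ I, w i x t) := by
  classical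
  induction I using Finset.induction_on with
  | empty => simpa using symClass_zero
  | insert a I ha ih =>
    simp only [Finset.sum_insert ha]
    exact (h a (by simp)).add (ih fun i hi => h i (by simp [hi]))

theorem symClass_time {c : ℝ → ℂ} (hc : ContDiff ℝ ∞ c) : SymClass 0 (fun _ t => c t) := by
  refine ⟨smoothIn_time hc, fun n R => ?_⟩
  have key : ∀ c : ℝ → ℂ, ContDiff ℝ ∞ c → ∃ C, 0 ≤ C ∧
      ∀ x ∈ Ioi (0 : ℝ), 1 ≤ x → ∀ t ∈ Icc (-R) R, ‖c t‖ ≤ C * x ^ (0 : ℝ) := fun c hc => by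
    obtain ⟨C, hC⟩ := isCompact_Icc.exists_bound_of_continuousOn (s := Icc (-R) R)
      hc.continuous.continuousOn
    refine ⟨max C 0, le_max_right _ _, fun x _ _ t ht => ?_⟩
    rw [Real.rpow_zero, mul_one]
    exact (hC t ht).trans (le_max_left _ _)
  induction n generalizing c with
  | zero => exact key c hc
  | succ n ih =>
    obtain ⟨C, hC, h⟩ := key c hc
    refine exists_symB_succ hC h ⟨0, le_rfl, ?_⟩ (ih (contDiff_infty_iff_deriv.1 hc).2)
    have : dX (fun _ t => c t) = fun _ _ => 0 := by funext x t; simp [_root_.dX]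
    rw [this]
    exact symB_zero le_rfl

theorem symClass_const (c : ℂ) : SymClass 0 (fun _ _ => c) := symClass_time contDiff_const

theorem SymClass.const_mul (c : ℂ) (hu : SymClass γ u) : SymClass γ (fun x t => c * u x t) := by
  simpa using (symClass_const c).mul hu

theorem hasDerivAt_ofReal_rpow (γ : ℝ) {x : ℝ} (hx : 0 < x) :
    HasDerivAt (fun y : ℝ => ((y ^ γ : ℝ) : ℂ)) ((γ : ℂ) * ((x ^ (γ - 1) : ℝ) : ℂ)) x := by
  simpa using (Real.hasDerivAt_rpow_const (p := γ) (Or.inl hx.ne')).ofReal_comp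

theorem contDiffOn_ofReal_rpow (γ : ℝ) :
    ContDiffOn ℝ ∞ (fun y : ℝ => ((y ^ γ : ℝ) : ℂ)) (Ioi 0) := fun _ hx =>
  (Complex.ofRealCLM.contDiff.contDiffAt.comp _
    (Real.contDiffAt_rpow_const_of_ne (ne_of_gt hx))).contDiffWithinAt

theorem symClass_rpow (γ : ℝ) : SymClass γ (fun x _ => ((x ^ γ : ℝ) : ℂ)) := by
  refine ⟨smoothIn_space (contDiffOn_ofReal_rpow γ), fun n R => ?_⟩
  have key : ∀ γ : ℝ, ∀ x ∈ Ioi (0 : ℝ), 1 ≤ x → ∀ t ∈ Icc (-R) R,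
      ‖((x ^ γ : ℝ) : ℂ)‖ ≤ 1 * x ^ γ := fun γ x hx _ t _ => by
    rw [Complex.norm_real, Real.norm_of_nonneg (Real.rpow_nonneg (le_of_lt hx) _), one_mul]
  induction n generalizing γ with
  | zero => exact ⟨1, zero_le_one, key γ⟩
  | succ n ih =>
    refine exists_symB_succ zero_le_one (key γ) ?_ ⟨0, le_rfl, ?_⟩
    · obtain ⟨C, hC, h⟩ := ih (γ - 1)
      obtain ⟨C', hC', h'⟩ := (symClass_const (γ : ℂ)).2 n R
      have := SymB.mul isOpen_Ioi (smoothIn_const _)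
        (smoothIn_space (contDiffOn_ofReal_rpow (γ - 1))) hC' hC h' h
      rw [zero_add] at this
      exact ⟨_, by positivity, this.congr isOpen_Ioi fun x hx t =>
        (hasDerivAt_ofReal_rpow γ hx).deriv⟩
    · have : dT (fun x _ => ((x ^ γ : ℝ) : ℂ)) = fun _ _ => 0 := by
        funext x t; simp [_root_.dT]
      rw [this]
      exact symB_zero le_rfl

theorem symClass_of_eventually_zero (γ : ℝ) (hu : SmoothIn (Ioi 0) u) {A : ℝ}
    (h0 : ∀ x, A < x → ∀ t, u x t = 0) : SymClass γ u := by
  refine ⟨hu, fun n R => ?_⟩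
  have key : ∀ (γ : ℝ) (u : ℝ → ℝ → ℂ), SmoothIn (Ioi 0) u → (∀ x, A < x → ∀ t, u x t = 0) →
      ∃ C, 0 ≤ C ∧ ∀ x ∈ Ioi (0 : ℝ), 1 ≤ x → ∀ t ∈ Icc (-R) R, ‖u x t‖ ≤ C * x ^ γ := by
    intro γ u hu h0
    have hc : ContinuousOn (Function.uncurry fun x t => u x t * ((x ^ (-γ) : ℝ) : ℂ))
        (Icc 1 A ×ˢ Icc (-R) R) :=
      (ContDiffOn.continuousOn (hu.mul (symClass_rpow (-γ)).1)).mono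
        (prod_mono (fun x hx => lt_of_lt_of_le one_pos hx.1) (subset_univ _))
    obtain ⟨C, hC⟩ := (isCompact_Icc.prod isCompact_Icc).exists_bound_of_continuousOn hc
    refine ⟨max C 0, le_max_right _ _, fun x hx h1 t ht => ?_⟩
    have hx0 : 0 < x := hx
    rcases le_or_gt x A with hxA | hxA
    · have := hC (x, t) ⟨⟨h1, hxA⟩, ht⟩
      rw [Function.uncurry_apply_pair, norm_mul, Complex.norm_real,
        Real.norm_of_nonneg (Real.rpow_nonneg hx0.le _), Real.rpow_neg hx0.le,
        ← div_eq_mul_inv, div_le_iff₀ (Real.rpow_pos_of_pos hx0 _)] at this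
      exact this.trans (mul_le_mul_of_nonneg_right (le_max_left _ _) (Real.rpow_nonneg hx0.le _))
    · rw [h0 x hxA, norm_zero]
      exact mul_nonneg (le_max_right _ _) (Real.rpow_nonneg hx0.le _)
  induction n generalizing u γ with
  | zero => exact key γ u hu h0
  | succ n ih =>
    obtain ⟨C, hC, h⟩ := key γ u hu h0
    have hX := dX_congr (s := Ioi A) (v := fun _ _ => 0) isOpen_Ioi h0
    have hT := dT_congr (s := Ioi A) (v := fun _ _ => 0) h0
    exact exists_symB_succ hC h
      (ih _ (hu.dX isOpen_Ioi) fun x hx t => by rw [hX x hx t]; simp [_root_.dX])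
      (ih _ (hu.dT isOpen_Ioi) fun x hx t => by rw [hT x hx t]; simp [_root_.dT])

theorem exists_symB_dilation {g : ℝ → ℂ} (hg : ContDiff ℝ ∞ g) {A : ℝ} {c : ℂ}
    (hA : ∀ z, A < z → g z = c) (n : ℕ) (R : ℝ) :
    ∃ C, 0 ≤ C ∧ ∀ ρ : ℝ, 0 < ρ → SymB (Ioi 0) R C n 0 (fun x _ => g (x / ρ)) := by
  have key : ∀ (g : ℝ → ℂ), ContDiff ℝ ∞ g → ∀ c : ℂ, (∀ z, A < z → g z = c) →
      ∃ C, 0 ≤ C ∧ ∀ ρ : ℝ, 0 < ρ → ∀ x ∈ Ioi (0 : ℝ), 1 ≤ x → ∀ t ∈ Icc (-R) R,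
        ‖g (x / ρ)‖ ≤ C * x ^ (0 : ℝ) := by
    intro g hg c hA
    obtain ⟨C, hC⟩ := isCompact_Icc.exists_bound_of_continuousOn (s := Icc 0 A)
      hg.continuous.continuousOn
    refine ⟨max C ‖c‖, le_trans (norm_nonneg c) (le_max_right _ _), fun ρ hρ x hx _ t _ => ?_⟩
    rw [Real.rpow_zero, mul_one]
    rcases le_or_gt (x / ρ) A with h | h
    · exact (hC _ ⟨(div_pos hx hρ).le, h⟩).trans (le_max_left _ _)
    · rw [hA _ h]; exact le_max_right _ _
  induction n generalizing g c with
  | zero => exact key g hg c hA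
  | succ n ih =>
    obtain ⟨C, hC, h⟩ := key g hg c hA
    have hg' : ContDiff ℝ ∞ (fun z : ℝ => (z : ℂ) * deriv g z) :=
      Complex.ofRealCLM.contDiff.mul (contDiff_infty_iff_deriv.1 hg).2
    obtain ⟨C1, hC1, h1⟩ := ih hg' (c := 0) fun z hz => by
      have : deriv g z = deriv (fun _ => c) z := Filter.EventuallyEq.deriv_eq
        (Filter.mem_of_superset (isOpen_Ioi.mem_nhds hz) fun y hy => hA y hy)
      rw [this]; simp
    obtain ⟨C2, hC2, h2⟩ := (symClass_rpow (-1)).2 n R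
    refine ⟨C + 2 ^ n * (C2 * C1), by positivity, fun ρ hρ => ⟨fun x hx hx1 t ht =>
      (h ρ hρ x hx hx1 t ht).trans ?_, ?_, ?_⟩⟩
    · rw [Real.rpow_zero, mul_one, mul_one]
      exact le_add_of_nonneg_right (by positivity)
    · have := SymB.mul isOpen_Ioi (symClass_rpow (-1)).1 (smoothIn_space (hg'.comp
        (contDiff_id.div_const ρ)).contDiffOn) hC2 hC1 h2 (h1 ρ hρ)
      rw [add_zero] at this
      rw [zero_sub]
      refine (this.mono_const (le_add_of_nonneg_left hC)).congr isOpen_Ioi fun x hx t => ?_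
      have hx0 : (0 : ℝ) < x := hx
      have hd : HasDerivAt (fun y : ℝ => g (y / ρ)) ((1 / ρ) • deriv g (x / ρ)) x :=
        HasDerivAt.scomp x ((hg.differentiable (by simp)).differentiableAt.hasDerivAt)
          ((hasDerivAt_id x).div_const ρ)
      rw [_root_.dX, hd.deriv, Real.rpow_neg_one, Complex.real_smul]
      push_cast
      have h1 : (x : ℂ) ≠ 0 := by exact_mod_cast hx0.ne'
      have h2 : (ρ : ℂ) ≠ 0 := by exact_mod_cast hρ.ne'
      simp only [Function.comp, id]
      push_cast
      field_simp
    · have : dT (fun x _ => g (x / ρ)) = fun _ _ => 0 := by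
        funext x t; simp [_root_.dT]
      rw [this]
      exact symB_zero (by positivity)

theorem SymClass.pd_bound (h : SymClass γ u) (i j : ℕ) (R : ℝ) : ∃ C > (0 : ℝ), ∀ x : ℝ, 1 ≤ x →
    ∀ t ∈ Icc (-R) R, ‖pd u i j x t‖ ≤ C * x ^ (γ - (j : ℝ)) := by
  obtain ⟨C, hC, h⟩ := h.2 (i + j) R
  refine ⟨C + 1, by positivity, fun x hx t ht => ?_⟩
  rw [pd_eq_iterate]
  have := ((SymB.iterate_dX (n := i) j h).mono_nat le_rfl)
  have := (SymB.iterate_dT (n := 0) i (by simpa using this)).mono_const (C' := C + 1) (by linarith)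
  exact this.bound x (lt_of_lt_of_le one_pos hx) hx t ht

end SymClass

/-- A smooth cutoff, equal to `0` on `(-∞, 1]` and to `1` on `[2, ∞)`. -/
def cutoff (z : ℝ) : ℂ := (Real.smoothTransition (z - 1) : ℂ)

theorem contDiff_cutoff : ContDiff ℝ ∞ cutoff :=
  Complex.ofRealCLM.contDiff.comp
    (Real.smoothTransition.contDiff.comp (contDiff_id.sub contDiff_const))

theorem cutoff_of_le {z : ℝ} (h : z ≤ 1) : cutoff z = 0 := by
  rw [cutoff, Real.smoothTransition.zero_of_nonpos (by linarith), Complex.ofReal_zero]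

theorem cutoff_of_ge {z : ℝ} (h : 2 ≤ z) : cutoff z = 1 := by
  rw [cutoff, Real.smoothTransition.one_of_one_le (by linarith), Complex.ofReal_one]

/-- The term `c(t) x^γ`, cut off to the region `x ≥ ρ`. -/
def cutTerm (c : ℝ → ℂ) (γ ρ x t : ℝ) : ℂ := c t * (((x ^ γ : ℝ) : ℂ) * cutoff (x / ρ))

section cutTerm

variable {c : ℝ → ℂ} {γ ρ : ℝ}

theorem cutTerm_of_le (hρ : 0 < ρ) {x : ℝ} (hx : x ≤ ρ) (t : ℝ) : cutTerm c γ ρ x t = 0 := by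
  rw [cutTerm, cutoff_of_le ((div_le_one hρ).2 hx), mul_zero, mul_zero]

theorem cutTerm_of_ge (hρ : 0 < ρ) {x : ℝ} (hx : 2 * ρ ≤ x) (t : ℝ) :
    cutTerm c γ ρ x t = c t * ((x ^ γ : ℝ) : ℂ) := by
  rw [cutTerm, cutoff_of_ge ((le_div_iff₀ hρ).2 hx), mul_one]

theorem smooth2_of_smoothIn {u : ℝ → ℝ → ℂ} (h : ∀ x, ∃ s, IsOpen s ∧ x ∈ s ∧ SmoothIn s u) :
    Smooth2 u := by
  refine smoothIn_univ.1 ?_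
  rintro ⟨x, t⟩ -
  obtain ⟨s, hs, hx, hu⟩ := h x
  exact (hu.contDiffAt hs hx t).contDiffWithinAt

theorem smoothIn_cutoff_div (s : Set ℝ) (ρ : ℝ) : SmoothIn s (fun x _ => cutoff (x / ρ)) :=
  smoothIn_space (contDiff_cutoff.comp (contDiff_id.div_const ρ)).contDiffOn

theorem smooth2_cutTerm (hc : ContDiff ℝ ∞ c) (γ : ℝ) (hρ : 0 < ρ) :
    Smooth2 (cutTerm c γ ρ) := by
  refine smooth2_of_smoothIn fun x => ?_
  rcases lt_or_ge x ρ with h | h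
  · exact ⟨Iio ρ, isOpen_Iio, h, (smoothIn_const 0).congr fun y hy t =>
      cutTerm_of_le hρ (le_of_lt hy) t⟩
  · exact ⟨Ioi 0, isOpen_Ioi, lt_of_lt_of_le hρ h, (smoothIn_time hc).mul
      ((symClass_rpow γ).1.mul (smoothIn_cutoff_div _ ρ))⟩

theorem exists_symB_cutTerm (hc : ContDiff ℝ ∞ c) (γ : ℝ) (n : ℕ) (R : ℝ) :
    ∃ C, 0 ≤ C ∧ ∀ ρ : ℝ, 0 < ρ → SymB (Ioi 0) R C n γ (cutTerm c γ ρ) := by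
  obtain ⟨C1, hC1, h1⟩ := (symClass_time hc).2 n R
  obtain ⟨C2, hC2, h2⟩ := (symClass_rpow γ).2 n R
  obtain ⟨C3, hC3, h3⟩ := exists_symB_dilation contDiff_cutoff
    (fun z (hz : 2 < z) => cutoff_of_ge hz.le) n R
  refine ⟨2 ^ n * (C1 * (2 ^ n * (C2 * C3))), by positivity, fun ρ hρ => ?_⟩
  have := SymB.mul isOpen_Ioi (smoothIn_time hc)
    ((symClass_rpow γ).1.mul (smoothIn_cutoff_div _ ρ)) hC1 (by positivity) h1
    (SymB.mul isOpen_Ioi (symClass_rpow γ).1 (smoothIn_cutoff_div _ ρ) hC2 hC3 h2 (h3 ρ hρ))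
  rwa [zero_add, add_zero] at this

theorem symClass_cutTerm (hc : ContDiff ℝ ∞ c) (γ : ℝ) (hρ : 0 < ρ) : SymClass γ (cutTerm c γ ρ) :=
  ⟨(smooth2_cutTerm hc γ hρ).smoothIn _, fun n R =>
    let ⟨C, hC, h⟩ := exists_symB_cutTerm hc γ n R; ⟨C, hC, h ρ hρ⟩⟩

theorem exists_small_cutTerm (hc : ContDiff ℝ ∞ c) {δ : ℝ} (hδ : γ < δ) (n : ℕ) (R A : ℝ)
    {ε : ℝ} (hε : 0 < ε) :
    ∃ ρ, 1 ≤ ρ ∧ A ≤ ρ ∧ SymB (Ioi 0) R ε n δ (cutTerm c γ ρ) := by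
  obtain ⟨C, hC, h⟩ := exists_symB_cutTerm hc γ n R
  have hlim : Filter.Tendsto (fun ρ : ℝ => C * ρ ^ (γ - δ)) Filter.atTop (nhds 0) := by
    have := (tendsto_rpow_neg_atTop (sub_pos.2 hδ)).const_mul C
    simpa using this
  obtain ⟨ρ, hρ, h1, hA⟩ := ((hlim.eventually_le_const hε).and
    ((Filter.eventually_ge_atTop 1).and (Filter.eventually_ge_atTop A))).exists
  have hρ0 : 0 < ρ := by linarith
  exact ⟨ρ, h1, hA, ((h ρ hρ0).of_vanish hρ0 hC hδ.le fun x hx t =>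
    cutTerm_of_le hρ0 hx.le t).mono_const hρ⟩

end cutTerm

/-- Borel summation of a formal series with smooth time-dependent coefficients. -/
theorem exists_borel_sum {e : ℕ → ℝ} (he : StrictAnti e) {c : ℕ → ℝ → ℂ}
    (hc : ∀ k, ContDiff ℝ ∞ (c k)) :
    ∃ F : ℝ → ℝ → ℂ, Smooth2 F ∧ (∀ x ≤ 0, ∀ t, F x t = 0) ∧
      ∀ N, SymClass (e (N + 1)) (fun x t => F x t -
        ∑ k ∈ Finset.range (N + 1), c k t * ((x ^ e k : ℝ) : ℂ)) := by
  have hex : ∀ k : ℕ, ∃ ρ : ℝ, 1 ≤ ρ ∧ (k : ℝ) ≤ ρ ∧ ∀ m, k = m + 1 →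
      SymB (Ioi 0) k ((1 / 2) ^ k) k (e m) (cutTerm (c k) (e k) ρ) := by
    intro k
    rcases k with _ | m
    · exact ⟨1, le_rfl, by simp, fun m hm => by omega⟩
    · obtain ⟨ρ, h1, hA, h⟩ := exists_small_cutTerm (hc (m + 1)) (he m.lt_succ_self) (m + 1)
        ((m + 1 : ℕ) : ℝ) ((m + 1 : ℕ) : ℝ) (ε := (1 / 2) ^ (m + 1)) (by positivity)
      refine ⟨ρ, h1, hA, fun m' hm' => ?_⟩
      obtain rfl : m = m' := by omega
      exact h
  choose ρ hρ1 hρk hsmall using hex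
  have hρ0 : ∀ k, 0 < ρ k := fun k => lt_of_lt_of_le one_pos (hρ1 k)
  set T : ℕ → ℝ → ℝ → ℂ := fun k => cutTerm (c k) (e k) (ρ k) with hT
  have hTs : ∀ k, Smooth2 (T k) := fun k => smooth2_cutTerm (hc k) _ (hρ0 k)
  set F : ℝ → ℝ → ℂ := fun x t => ∑ k ∈ Finset.range ⌈x⌉₊, T k x t with hF
  have hFK : ∀ (K : ℕ) (x : ℝ), x ≤ K → ∀ t, F x t = ∑ k ∈ Finset.range K, T k x t := by
    intro K x hx t
    refine Finset.sum_subset (Finset.range_mono (Nat.ceil_le.2 hx)) fun k _ hk => ?_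
    rw [Finset.mem_range, not_lt, Nat.ceil_le] at hk
    exact cutTerm_of_le (hρ0 k) (hk.trans (hρk k)) t
  refine ⟨F, smooth2_of_smoothIn fun x => ?_, fun x hx t => ?_, fun N => ?_⟩
  · obtain ⟨K, hK⟩ := exists_nat_gt x
    exact ⟨Iio K, isOpen_Iio, hK, (SmoothIn.sum (I := Finset.range K)
      fun k _ => (hTs k).smoothIn _).congr fun y hy t => hFK K y (le_of_lt hy) t⟩
  · rw [hFK 0 x (by simpa using hx), Finset.range_zero, Finset.sum_empty]
  have hFs : SmoothIn (Ioi 0) F := by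
    intro p hp
    obtain ⟨K, hK⟩ := exists_nat_gt p.1
    have h : SmoothIn (Iio (K : ℝ)) F := (SmoothIn.sum (I := Finset.range K)
      fun k _ => (hTs k).smoothIn _).congr fun y hy t => hFK K y (le_of_lt hy) t
    exact (h.contDiffAt isOpen_Iio hK p.2).contDiffWithinAt
  have hP : ∀ k, SymClass (e k) (fun x t => c k t * ((x ^ e k : ℝ) : ℂ)) := fun k => by
    simpa using (symClass_time (hc k)).mul (symClass_rpow (e k))
  have hhead : ∀ M, SymClass (e (N + 1)) (fun x t => (∑ k ∈ Finset.range (N + 1),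
      (T k x t - c k t * ((x ^ e k : ℝ) : ℂ))) + ∑ k ∈ Finset.Ico (N + 1) M, T k x t) := by
    refine fun M => SymClass.add (SymClass.sum fun k _ => ?_) (SymClass.sum fun k hk => ?_)
    · refine symClass_of_eventually_zero (A := 2 * ρ k) _ (((hTs k).smoothIn _).sub (hP k).1)
        fun x hx t => ?_
      rw [hT]
      dsimp only
      rw [cutTerm_of_ge (hρ0 k) hx.le, sub_self]
    · exact (symClass_cutTerm (hc k) _ (hρ0 k)).mono (he.antitone (Finset.mem_Ico.1 hk).1)
  refine ⟨hFs.sub (SmoothIn.sum fun k _ => (hP k).1), fun n R => ?_⟩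
  obtain ⟨M, hMN, hMn, hMR⟩ : ∃ M : ℕ, N + 1 ≤ M ∧ n ≤ M ∧ R ≤ M :=
    ⟨max (N + 1) (max n ⌈R⌉₊), le_max_left _ _, (le_max_left _ _).trans (le_max_right _ _),
      (Nat.le_ceil R).trans (by exact_mod_cast (le_max_right _ _).trans (le_max_right _ _))⟩
  obtain ⟨C, hC, hh⟩ := (hhead (M + 1)).2 n R
  have htail_smooth : SmoothIn (Ioi 0) (fun x t => F x t -
      ∑ k ∈ Finset.range (M + 1), T k x t) :=
    hFs.sub (SmoothIn.sum fun k _ => (hTs k).smoothIn _)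
  have htail : SymB (Ioi 0) R 2 n (e (N + 1)) (fun x t => F x t -
      ∑ k ∈ Finset.range (M + 1), T k x t) := by
    refine SymB.of_forall_Ioo fun X => ?_
    obtain ⟨K', hK'⟩ := exists_nat_ge X
    obtain ⟨K, hKX, hKM⟩ : ∃ K : ℕ, X ≤ K ∧ M + 1 ≤ K :=
      ⟨max K' (M + 1), hK'.trans (by exact_mod_cast le_max_left _ _), le_max_right _ _⟩
    have hb : SymB (Ioo 0 X) R (∑ k ∈ Finset.Ico (M + 1) K, (1 / 2 : ℝ) ^ k) n (e (N + 1))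
        (fun x t => ∑ k ∈ Finset.Ico (M + 1) K, T k x t) := by
      refine SymB.sum isOpen_Ioo (fun k _ => (hTs k).smoothIn _) fun k hk => ?_
      have hk' := (Finset.mem_Ico.1 hk).1
      obtain ⟨m, rfl⟩ : ∃ m, k = m + 1 := ⟨k - 1, by omega⟩
      refine ((((hsmall (m + 1) m rfl).mono_order (by positivity)
        (he.antitone (show N + 1 ≤ m by omega))).mono_nat (by omega)).mono_time ?_).mono_set
        fun x hx => hx.1
      exact hMR.trans (by exact_mod_cast (by omega : M ≤ m + 1))
    refine (hb.mono_const ?_).congr isOpen_Ioo fun x hx t => ?_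
    · refine (Finset.sum_le_sum_of_subset_of_nonneg (t := Finset.range K) ?_
        fun _ _ _ => by positivity).trans (sum_geometric_two_le K)
      intro k hk
      exact Finset.mem_range.2 (Finset.mem_Ico.1 hk).2
    · rw [hFK K x (hx.2.le.trans hKX), Finset.sum_Ico_eq_sub _ hKM]
  refine ⟨C + 2, by positivity,
    (SymB.add isOpen_Ioi (hhead (M + 1)).1 htail_smooth hh htail).congr isOpen_Ioi
      fun x _ t => ?_⟩
  rw [Finset.sum_sub_distrib, Finset.sum_Ico_eq_sub _ (by omega)]
  ring

/-- The closure of a set of exponents under addition and under subtraction of `2`. -/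
inductive ExpClosure (e : ℕ → ℝ) : ℝ → Prop
  | base (k : ℕ) : ExpClosure e (e k)
  | sub_two {x : ℝ} : ExpClosure e x → ExpClosure e (x - 2)
  | add {x y : ℝ} : ExpClosure e x → ExpClosure e y → ExpClosure e (x + y)

section Exponents

variable {e : ℕ → ℝ} {β : ℝ}

theorem ExpClosure.le (hβ : β ≤ 0) (he : IsExp β e) {x : ℝ} (hx : ExpClosure e x) : x ≤ β := by
  induction hx with
  | base k => rw [← he.1]; exact he.2.1.antitone (Nat.zero_le k)
  | sub_two _ ih => linarith
  | add _ _ ih1 ih2 => linarith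

theorem ExpClosure.exists_gap (hβ : β ≤ 0) (he : IsExp β e) :
    ∃ δ, 0 < δ ∧ δ ≤ 2 ∧ ∀ x, ExpClosure e x → x = 0 ∨ x ≤ -δ := by
  have h1 : e 1 < 0 := lt_of_lt_of_le (he.2.1 zero_lt_one) (he.1.le.trans hβ)
  have h0 : e 0 ≤ 0 := he.1.le.trans hβ
  obtain ⟨δ, hδ0, hδ2, hδ1, hδ⟩ : ∃ δ, 0 < δ ∧ δ ≤ 2 ∧ e 1 ≤ -δ ∧ (e 0 = 0 ∨ e 0 ≤ -δ) := by
    rcases h0.eq_or_lt with h | h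
    · exact ⟨min 2 (-e 1), lt_min two_pos (by linarith), min_le_left _ _,
        by linarith [min_le_right 2 (-e 1)], Or.inl h⟩
    · have := he.2.1 zero_lt_one
      exact ⟨min 2 (-e 0), lt_min two_pos (by linarith), min_le_left _ _,
        by linarith [min_le_right 2 (-e 0)], Or.inr (by linarith [min_le_right 2 (-e 0)])⟩
  refine ⟨δ, hδ0, hδ2, fun x hx => ?_⟩
  induction hx with
  | base k =>
    rcases k with _ | k
    · exact hδ
    · exact Or.inr ((he.2.1.antitone (Nat.succ_le_succ (Nat.zero_le k))).trans hδ1)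
  | sub_two _ ih => right; rcases ih with h | h <;> linarith
  | add _ _ ih1 ih2 =>
    rcases ih1 with h | h <;> rcases ih2 with h' | h'
    · left; linarith
    all_goals right; linarith

theorem ExpClosure.finite_above (hβ : β ≤ 0) (he : IsExp β e) (M : ℝ) :
    {x | ExpClosure e x ∧ M < x}.Finite := by
  obtain ⟨δ, hδ0, hδ2, hδ⟩ := ExpClosure.exists_gap hβ he
  have key : ∀ n : ℕ, {x | ExpClosure e x ∧ -(n * δ) < x}.Finite := by
    intro n
    induction n with
    | zero =>
      convert Set.finite_empty (α := ℝ)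
      ext x
      simp only [Set.mem_ofPred_eq, mem_empty_iff_false, iff_false, not_and, not_lt]
      intro hx
      have := hx.le hβ he
      simp; linarith
    | succ n ih =>
      have hb : {k | -((n + 1 : ℕ) * δ) < e k}.Finite := by
        have := (he.2.2.eventually_le_atBot (-((n + 1 : ℕ) * δ)))
        rw [Filter.eventually_atTop] at this
        obtain ⟨K, hK⟩ := this
        refine (Set.finite_lt_nat K).subset fun k hk => ?_
        by_contra hc
        exact absurd (hK k (not_lt.1 hc)) (not_le.2 hk)
      refine ((hb.image e).union ((ih.image (· - 2)).union (ih.image2 (· + ·) ih))).subset ?_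
      rintro x ⟨hx, hxM⟩
      push_cast at hxM
      induction hx with
      | base k => exact Or.inl ⟨k, by simpa using hxM, rfl⟩
      | @sub_two x hx _ => exact Or.inr (Or.inl ⟨x, ⟨hx, by linarith⟩, rfl⟩)
      | @add x y hx hy ihx ihy =>
        rcases hδ x hx with h | h
        · rw [h, zero_add] at hxM ⊢
          exact ihy hxM
        rcases hδ y hy with h' | h'
        · rw [h', add_zero] at hxM ⊢
          exact ihx hxM
        exact Or.inr (Or.inr ⟨x, ⟨hx, by linarith⟩, y, ⟨hy, by linarith⟩, rfl⟩)
  obtain ⟨n, hn⟩ := exists_nat_gt (-M / δ)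
  refine (key n).subset fun x hx => ⟨hx.1, ?_⟩
  rw [div_lt_iff₀ hδ0] at hn
  linarith [hx.2]

theorem exists_closed_exponents (hβ : β ≤ 0) (he : IsExp β e) :
    ∃ e' : ℕ → ℝ, IsExp β e' ∧ (∀ k, ∃ l, e' l = e k) ∧ (∀ k, ∃ l, e' l = e' k - 2) ∧
      ∀ k m, ∃ l, e' l = e' k + e' m := by
  let ι := {y : ℝ // ExpClosure e (-y)}
  have hbot : ExpClosure e (- -β) := by rw [neg_neg, ← he.1]; exact .base 0
  have hle : ∀ y : ι, (⟨-β, hbot⟩ : ι) ≤ y := fun y =>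
    Subtype.mk_le_mk.2 (by linarith [y.2.le hβ he])
  let : OrderBot ι := { bot := ⟨-β, hbot⟩, bot_le := hle }
  let : LocallyFiniteOrder ι := LocallyFiniteOrder.ofFiniteIcc fun a b => by
    refine Set.Finite.of_finite_image (f := fun y : ι => -(y : ℝ)) ?_
      fun x _ y _ h => Subtype.ext (neg_injective h)
    refine (ExpClosure.finite_above hβ he (-(b : ℝ) - 1)).subset ?_
    rintro _ ⟨y, hy, rfl⟩
    refine ⟨y.2, ?_⟩
    have : (y : ℝ) ≤ b := hy.2
    linarith
  let : SuccOrder ι := LinearLocallyFiniteOrder.succOrder ι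
  let : PredOrder ι := LinearLocallyFiniteOrder.predOrder ι
  have : NoMaxOrder ι := ⟨fun a => ⟨⟨(a : ℝ) + 2, by
    rw [neg_add, ← sub_eq_add_neg]; exact .sub_two a.2⟩, Subtype.mk_lt_mk.2 (by linarith)⟩⟩
  let φ : ι ≃o ℕ := orderIsoNatOfLinearSuccPredArch
  have hmem : ∀ x, ExpClosure e x → ∃ l, -((φ.symm l : ι) : ℝ) = x := fun x hx =>
    ⟨φ ⟨-x, by rwa [neg_neg]⟩, by simp⟩
  have hanti : StrictAnti fun k => -((φ.symm k : ι) : ℝ) := fun k m hkm =>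
    neg_lt_neg (φ.symm.strictMono hkm)
  refine ⟨fun k => -((φ.symm k : ι) : ℝ), ⟨?_, hanti, ?_⟩, fun k => hmem _ (.base k),
    fun k => hmem _ (.sub_two (φ.symm k).2), fun k m => hmem _ (.add (φ.symm k).2 (φ.symm m).2)⟩
  · have : φ.symm 0 = ⊥ := φ.symm.map_bot
    simp only [this]
    exact neg_neg β
  · refine Filter.tendsto_atTop_atBot.2 fun b => ?_
    obtain ⟨k, hk⟩ := (he.2.2.eventually_le_atBot b).exists
    obtain ⟨l, hl⟩ := hmem _ (.base k)
    exact ⟨l, fun m hm => (hanti.antitone hm).trans (hl.le.trans hk)⟩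

end Exponents

theorem exists_recursive_seq {X : Type*} [Inhabited X] (Φ : ℕ → (ℕ → X) → X)
    (hΦ : ∀ k c c', (∀ m < k, c m = c' m) → Φ k c = Φ k c') : ∃ c : ℕ → X, ∀ k, c k = Φ k c := by
  refine ⟨WellFounded.fix (C := fun _ => X) Nat.lt_wfRel.wf
    (fun k ih => Φ k fun m => if h : m < k then ih m h else default), fun k => ?_⟩
  rw [WellFounded.fix_eq]
  exact hΦ _ _ _ fun m hm => dif_pos hm

theorem exists_antideriv {G : ℝ → ℂ} (hG : ContDiff ℝ ∞ G) :
    ∃ K : ℝ → ℂ, ContDiff ℝ ∞ K ∧ K 0 = 0 ∧ ∀ t, HasDerivAt K (G t) t := by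
  have hd : ∀ t, HasDerivAt (fun t => ∫ s in (0 : ℝ)..t, G s) (G t) t := fun t =>
    hG.continuous.integral_hasStrictDerivAt 0 t |>.hasDerivAt
  refine ⟨_, contDiff_infty_iff_deriv.2 ⟨fun t => (hd t).differentiableAt, ?_⟩,
    intervalIntegral.integral_same, hd⟩
  rwa [funext fun t => (hd t).deriv]

/-- The exponential phase `exp(iμ|a|²t)`. -/
def phase (μ : ℝ) (a : ℂ) (t : ℝ) : ℂ := Complex.exp (Complex.I * (μ * (a * star a)) * t)

section Phase

variable (μ : ℝ) (a : ℂ)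

theorem phase_zero : phase μ a 0 = 1 := by simp [phase]

theorem phase_ne_zero (t : ℝ) : phase μ a t ≠ 0 := Complex.exp_ne_zero _

theorem hasDerivAt_phase (t : ℝ) :
    HasDerivAt (phase μ a) (Complex.I * (μ * (a * star a)) * phase μ a t) t := by
  have h := ((hasDerivAt_id t).ofReal_comp.const_mul (Complex.I * (μ * (a * star a)))).cexp
  refine h.congr_deriv ?_
  simp [phase, mul_comm]

theorem contDiff_phase : ContDiff ℝ ∞ (phase μ a) :=
  (contDiff_const.mul Complex.ofRealCLM.contDiff).cexp

theorem phase_mul_conj (t : ℝ) : phase μ a t * (starRingEnd ℂ) (phase μ a t) = 1 := by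
  rw [phase, ← Complex.exp_conj, ← Complex.exp_add, ← Complex.exp_zero]
  congr 1
  simp only [map_mul, Complex.conj_I, Complex.conj_ofReal, Complex.star_def, Complex.conj_conj]
  ring

end Phase

theorem exists_linearized_solution (μ : ℝ) (a α : ℂ) {G : ℝ → ℂ} (hG : ContDiff ℝ ∞ G) :
    ∃ d : ℝ → ℂ, ContDiff ℝ ∞ d ∧ d 0 = α ∧ ∀ t, Complex.I * deriv d t +
      μ * (2 * (a * (starRingEnd ℂ) a) * d t +
        (a * phase μ a t) ^ 2 * (starRingEnd ℂ) (d t)) + G t = 0 := by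
  set E := phase μ a with hE
  have hEs := contDiff_phase μ a
  have hcs : ∀ {g : ℝ → ℂ}, ContDiff ℝ ∞ g → ContDiff ℝ ∞ fun t => (starRingEnd ℂ) (g t) :=
    fun hg => Complex.conjCLE.contDiff.comp hg
  obtain ⟨K, hK, hK0, hKd⟩ := exists_antideriv (G := fun t => (starRingEnd ℂ) (E t) * G t)
    ((hcs hEs).mul hG)
  obtain ⟨L, hL, hL0, hLd⟩ := exists_antideriv hK
  set a' := (starRingEnd ℂ) a with ha'
  set r0 := a' * α + a * (starRingEnd ℂ) α with hr0
  set ρ : ℝ → ℂ := fun t => r0 * t + Complex.I * a' * L t -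
    Complex.I * a * (starRingEnd ℂ) (L t) with hρ
  set δ : ℝ → ℂ := fun t => α + Complex.I * (μ * a * ρ t + K t) with hδ
  have hδs : ContDiff ℝ ∞ δ :=
    contDiff_const.add (contDiff_const.mul ((contDiff_const.mul
      (((contDiff_const.mul Complex.ofRealCLM.contDiff).add (contDiff_const.mul hL)).sub
        (contDiff_const.mul (hcs hL)))).add hK))
  have hρd : ∀ t, HasDerivAt ρ (r0 + Complex.I * a' * K t -
      Complex.I * a * (starRingEnd ℂ) (K t)) t := fun t => by
    have h1 := ((hasDerivAt_id t).ofReal_comp.const_mul r0)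
    have h2 := (hLd t).const_mul (Complex.I * a')
    have h3 := ((hLd t).star).const_mul (Complex.I * a)
    refine ((h1.add h2).sub h3).congr_deriv ?_
    simp
  have hδd : ∀ t, HasDerivAt δ (Complex.I * (μ * a * (r0 + Complex.I * a' * K t -
      Complex.I * a * (starRingEnd ℂ) (K t)) + (starRingEnd ℂ) (E t) * G t)) t := fun t => by
    exact ((((hρd t).const_mul (μ * a : ℂ)).add (hKd t)).const_mul Complex.I).const_add α
  refine ⟨fun t => E t * δ t, hEs.mul hδs, ?_, fun t => ?_⟩
  · simp [hE, phase_zero, hδ, hρ, hL0, hK0]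
  · have hd : deriv (fun t => E t * δ t) t = _ := ((hasDerivAt_phase μ a t).mul (hδd t)).deriv
    rw [hd]
    have hEE := phase_mul_conj μ a t
    rw [← hE] at hEE ⊢
    have hρc : (starRingEnd ℂ) (ρ t) = ρ t := by
      simp only [hρ, hr0, map_sub, map_add, map_mul, Complex.conj_I, Complex.conj_ofReal,
        Complex.conj_conj, ha']
      ring
    have hr : a' * δ t + a * (starRingEnd ℂ) (δ t) =
        r0 + Complex.I * a' * K t - Complex.I * a * (starRingEnd ℂ) (K t) := by
      simp only [hδ, map_add, map_mul, Complex.conj_I, Complex.conj_ofReal, hρc, hr0]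
      rw [← ha']
      ring
    rw [map_mul, Complex.star_def, ← hr, ← ha']
    linear_combination (μ * a ^ 2 * E t * (starRingEnd ℂ) (δ t) - G t) * hEE +
      (μ * a * E t * (a' * δ t + a * (starRingEnd ℂ) (δ t)) +
        E t * (starRingEnd ℂ) (E t) * G t + μ * (a * a') * E t * δ t) * Complex.I_mul_I

/-- The part of the nonlinear Schrödinger residual of `∑ l < N, c l t * x ^ e l` at the power
`x ^ e k`, apart from the time derivative. -/
def formalForcing (μ : ℝ) (e : ℕ → ℝ) (c : ℕ → ℝ → ℂ) (N k : ℕ) (t : ℝ) : ℂ :=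
  ∑ l ∈ Finset.range N, (if e l - 2 = e k then ((e l * (e l - 1) : ℝ) : ℂ) * c l t else 0) +
    μ * ∑ p ∈ Finset.range N ×ˢ Finset.range N ×ˢ Finset.range N,
      (if e p.1 + e p.2.1 + e p.2.2 = e k then
        c p.1 t * c p.2.1 t * (starRingEnd ℂ) (c p.2.2 t) else 0)

section Formal

variable {μ : ℝ} {e : ℕ → ℝ} {c : ℕ → ℝ → ℂ} {N k : ℕ}

theorem contDiff_formalForcing (hc : ∀ k, ContDiff ℝ ∞ (c k)) :
    ContDiff ℝ ∞ (formalForcing μ e c N k) := by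
  refine .add (.sum fun l _ => ?_) (contDiff_const.mul (.sum fun p _ => ?_))
  · split_ifs
    · exact contDiff_const.mul (hc l)
    · exact contDiff_const
  · split_ifs
    · exact ((hc _).mul (hc _)).mul (Complex.conjCLE.contDiff.comp (hc _))
    · exact contDiff_const

theorem formalForcing_congr {c' : ℕ → ℝ → ℂ} {t : ℝ} (h : ∀ m < N, c m t = c' m t) :
    formalForcing μ e c N k t = formalForcing μ e c' N k t := by
  unfold formalForcing
  congr 1
  · exact Finset.sum_congr rfl fun l hl => by rw [h l (Finset.mem_range.1 hl)]
  · congr 1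
    refine Finset.sum_congr rfl fun p hp => ?_
    simp only [Finset.mem_product, Finset.mem_range] at hp
    rw [h _ hp.1, h _ hp.2.1, h _ hp.2.2]

theorem le_of_exponent_sum (he : StrictAnti e) (h0 : e 0 ≤ 0) {p : ℕ × ℕ × ℕ}
    (hp : e p.1 + e p.2.1 + e p.2.2 = e k) : p.1 ≤ k ∧ p.2.1 ≤ k ∧ p.2.2 ≤ k := by
  have hn : ∀ m, e m ≤ 0 := fun m => (he.antitone (Nat.zero_le m)).trans h0
  have h1 := hn p.1
  have h2 := hn p.2.1
  have h3 := hn p.2.2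
  refine ⟨?_, ?_, ?_⟩ <;> refine he.le_iff_ge.1 ?_ <;> linarith

theorem formalForcing_eq (he : StrictAnti e) (h0 : e 0 ≤ 0) (hk : k < N) (t : ℝ) :
    formalForcing μ e c N k t = formalForcing μ e c (k + 1) k t := by
  have hsub : Finset.range (k + 1) ⊆ Finset.range N := Finset.range_subset_range.2 hk
  unfold formalForcing
  congr 1
  · refine (Finset.sum_subset hsub fun l _ hl => if_neg fun h => hl ?_).symm
    have : e k < e l := by linarith
    exact Finset.mem_range.2 ((he.lt_iff_gt.1 this).trans k.lt_succ_self)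
  · congr 1
    refine (Finset.sum_subset (Finset.product_subset_product hsub
      (Finset.product_subset_product hsub hsub)) fun p _ hp => if_neg fun h => hp ?_).symm
    have := le_of_exponent_sum he h0 h
    simp only [Finset.mem_product, Finset.mem_range]
    omega

theorem formalForcing_split (he : StrictAnti e) (h0 : e 0 ≤ 0) (hk : ¬(k = 0 ∧ e 0 = 0)) (t : ℝ) :
    formalForcing μ e c (k + 1) k t =
      formalForcing μ e (fun m t => if m < k then c m t else 0) (k + 1) k t +
        μ * (if e 0 = 0 then 2 * (c 0 t * (starRingEnd ℂ) (c 0 t)) * c k t +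
          c 0 t ^ 2 * (starRingEnd ℂ) (c k t) else 0) := by
  have hn : ∀ m, e m ≤ 0 := fun m => (he.antitone (Nat.zero_le m)).trans h0
  unfold formalForcing
  rw [add_assoc, ← mul_add]
  congr 1
  · refine Finset.sum_congr rfl fun l _ => ?_
    split_ifs with h
    · have hl : l < k := he.lt_iff_gt.1 (by linarith)
      simp only [if_pos hl]
    · rfl
  congr 1
  split_ifs with he0
  · have hk0 : k ≠ 0 := fun h => hk ⟨h, he0⟩
    have hz : ∀ m, e m = 0 → m = 0 := fun m hm => he.injective (hm.trans he0.symm)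
    have hsplit : ∀ p ∈ Finset.range (k + 1) ×ˢ Finset.range (k + 1) ×ˢ Finset.range (k + 1),
        (if e p.1 + e p.2.1 + e p.2.2 = e k then
          c p.1 t * c p.2.1 t * (starRingEnd ℂ) (c p.2.2 t) else 0) =
        (if e p.1 + e p.2.1 + e p.2.2 = e k then
          (if p.1 < k then c p.1 t else 0) * (if p.2.1 < k then c p.2.1 t else 0) *
            (starRingEnd ℂ) (if p.2.2 < k then c p.2.2 t else 0) else 0) +
        ((if p = (k, 0, 0) then c k t * c 0 t * (starRingEnd ℂ) (c 0 t) else 0) +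
        ((if p = (0, k, 0) then c 0 t * c k t * (starRingEnd ℂ) (c 0 t) else 0) +
        (if p = (0, 0, k) then c 0 t * c 0 t * (starRingEnd ℂ) (c k t) else 0))) := by
      rintro ⟨l, m, n⟩ hp
      simp only [Finset.mem_product, Finset.mem_range, Nat.lt_succ_iff] at hp
      obtain ⟨hl, hm, hn'⟩ := hp
      by_cases h : e l + e m + e n = e k
      · have h1 := hn l
        have h2 := hn m
        have h3 := hn n
        rcases hl.eq_or_lt with rfl | hl
        · obtain rfl := hz m (by linarith)
          obtain rfl := hz n (by linarith)
          simp [hk0, hk0.symm, he0]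
        rcases hm.eq_or_lt with rfl | hm
        · obtain rfl := hz l (by linarith)
          obtain rfl := hz n (by linarith)
          simp [hk0, hk0.symm, he0]
        rcases hn'.eq_or_lt with rfl | hn'
        · obtain rfl := hz l (by linarith)
          obtain rfl := hz m (by linarith)
          simp [hk0, hk0.symm, he0]
        simp [h, hl, hm, hn', hl.ne, hm.ne, hn'.ne]
      · have h1 : (l, m, n) ≠ (k, 0, 0) := by rintro ⟨⟩; simp [he0] at h
        have h2 : (l, m, n) ≠ (0, k, 0) := by rintro ⟨⟩; simp [he0] at h
        have h3 : (l, m, n) ≠ (0, 0, k) := by rintro ⟨⟩; simp [he0] at h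
        simp only [h, h1, h2, h3, if_false, add_zero]
    rw [Finset.sum_congr rfl hsplit, Finset.sum_add_distrib, Finset.sum_add_distrib,
      Finset.sum_add_distrib, Finset.sum_ite_eq', Finset.sum_ite_eq', Finset.sum_ite_eq',
      if_pos (by simp), if_pos (by simp), if_pos (by simp)]
    ring
  · rw [add_zero]
    have hlt : ∀ m, e m < 0 := fun m =>
      (he.antitone (Nat.zero_le m)).trans_lt (lt_of_le_of_ne h0 he0)
    refine Finset.sum_congr rfl fun p _ => ?_
    split_ifs with h
    · have h1 := hlt p.1
      have h2 := hlt p.2.1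
      have h3 := hlt p.2.2
      have h1' : p.1 < k := he.lt_iff_gt.1 (by linarith)
      have h2' : p.2.1 < k := he.lt_iff_gt.1 (by linarith)
      have h3' : p.2.2 < k := he.lt_iff_gt.1 (by linarith)
      simp only [if_pos h1', if_pos h2', if_pos h3']
    · rfl

theorem formalForcing_eq_zero (he : StrictAnti e) (h0 : e 0 ≤ 0) (hk : ¬(k = 0 ∧ e 0 = 0)) {t : ℝ}
    (hc : ∀ m < k, c m t = 0) : formalForcing μ e c (k + 1) k t = 0 := by
  have hz : formalForcing μ e (fun m t => if m < k then c m t else 0) (k + 1) k t =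
      formalForcing μ e (fun _ _ => 0) (k + 1) k t :=
    formalForcing_congr fun m _ => by
      split_ifs with h
      exacts [hc m h, rfl]
  rw [formalForcing_split he h0 hk, hz]
  have : e 0 = 0 → c 0 t = 0 := fun h => hc 0 (Nat.pos_of_ne_zero fun h' => hk ⟨h', h⟩)
  split_ifs with h
  · simp [formalForcing, this h]
  · simp [formalForcing]

theorem exists_formal_solution (μ : ℝ) (he : StrictAnti e) (h0 : e 0 ≤ 0) (α : ℕ → ℂ) :
    ∃ c : ℕ → ℝ → ℂ, (∀ k, ContDiff ℝ ∞ (c k)) ∧ (∀ k, c k 0 = α k) ∧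
      (∀ k N, k < N → ∀ t, Complex.I * deriv (c k) t + formalForcing μ e c N k t = 0) ∧
      ∀ j, (∀ m < j, α m = 0) → (∀ m < j, ∀ t, c m t = 0) ∧ (α j ≠ 0 → ∀ t, c j t ≠ 0) := by
  let _ : Inhabited {g : ℝ → ℂ // ContDiff ℝ ∞ g} := ⟨⟨fun _ => 0, contDiff_const⟩⟩
  set a : ℂ := if e 0 = 0 then α 0 else 0 with ha
  choose S hS hS0 hSd using fun (k : ℕ) (d : ℕ → {g : ℝ → ℂ // ContDiff ℝ ∞ g}) =>
    exists_linearized_solution μ a (α k)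
      (contDiff_formalForcing (μ := μ) (e := e) (N := k + 1) (k := k) fun m => (d m).2)
  obtain ⟨c, hc⟩ := exists_recursive_seq (X := {g : ℝ → ℂ // ContDiff ℝ ∞ g})
    (fun k c => if k = 0 ∧ e 0 = 0 then ⟨fun t => α 0 * phase μ (α 0) t,
      contDiff_const.mul (contDiff_phase μ _)⟩ else
        ⟨S k fun m => if m < k then c m else default, hS k _⟩) (fun k c c' h => by
          have : (fun m => if m < k then c m else default) =
              fun m => if m < k then c' m else default := by
            ext1 m
            split_ifs with hm
            exacts [h m hm, rfl]
          rw [this])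
  have hzero : e 0 = 0 → ∀ t, (c 0).1 t = α 0 * phase μ (α 0) t := fun h t => by
    rw [hc 0, if_pos ⟨rfl, h⟩]
  have hpos : ∀ k, ¬(k = 0 ∧ e 0 = 0) →
      (c k).1 = S k fun m => if m < k then c m else default := fun k hk => by
    rw [hc k, if_neg hk]
  have hinit : ∀ k, (c k).1 0 = α k := fun k => by
    by_cases hk : k = 0 ∧ e 0 = 0
    · rw [hk.1, hzero hk.2, phase_zero, mul_one]
    · rw [hpos k hk, hS0]
  have hode : ∀ k t, Complex.I * deriv (c k).1 t +
      formalForcing μ e (fun m => (c m).1) (k + 1) k t = 0 := fun k t => by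
    by_cases hk : k = 0 ∧ e 0 = 0
    · obtain ⟨rfl, h⟩ := hk
      have hd : deriv (c 0).1 t =
          α 0 * (Complex.I * (μ * (α 0 * star (α 0))) * phase μ (α 0) t) := by
        rw [funext (hzero h)]
        exact ((hasDerivAt_phase μ (α 0) t).const_mul (α 0)).deriv
      have hE := phase_mul_conj μ (α 0) t
      simp only [hd, formalForcing, zero_add, Finset.range_one, Finset.singleton_product_singleton,
        Finset.sum_singleton, h, hzero h, map_mul, Complex.star_def]
      norm_num
      linear_combination (μ * α 0 ^ 2 * (starRingEnd ℂ) (α 0) * phase μ (α 0) t) *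
        (hE + Complex.I_mul_I)
    · have hdef : formalForcing μ e (fun m t => if m < k then (c m).1 t else 0) (k + 1) k t =
          formalForcing μ e
            (fun m => (if m < k then c m else default : {g : ℝ → ℂ // ContDiff ℝ ∞ g}).1)
            (k + 1) k t :=
        formalForcing_congr fun m _ => by
          split_ifs
          exacts [rfl, rfl]
      have hS' := hSd k (fun m => if m < k then c m else default) t
      rw [← hpos k hk, ha] at hS'
      rw [formalForcing_split he h0 hk, hdef]
      split_ifs at hS' ⊢ with h
      · have hE := phase_mul_conj μ (α 0) t
        rw [hzero h, map_mul]
        linear_combination hS' + (2 * μ * α 0 * (starRingEnd ℂ) (α 0) * (c k).1 t) * hE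
      · simpa using hS'
  have hconst : ∀ k, ¬(k = 0 ∧ e 0 = 0) → (∀ m < k, ∀ t, (c m).1 t = 0) →
      ∀ t, (c k).1 t = α k := fun k hk hm t => by
    rw [← hinit k]
    refine is_const_of_deriv_eq_zero ((c k).2.differentiable (by simp)) (fun s => ?_) t 0
    have := hode k s
    rw [formalForcing_eq_zero he h0 hk fun m h => hm m h s, add_zero] at this
    exact (mul_eq_zero.1 this).resolve_left Complex.I_ne_zero
  refine ⟨fun k => (c k).1, fun k => (c k).2, hinit, fun k N hk t => ?_, fun j hj => ?_⟩
  · rw [formalForcing_eq he h0 hk, hode k t]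
  · have hlow : ∀ m < j, ∀ t, (c m).1 t = 0 := fun m => by
      induction m using Nat.strong_induction_on with
      | _ m ih =>
        intro hm t
        by_cases hk : m = 0 ∧ e 0 = 0
        · rw [hk.1, hzero hk.2, hj 0 (hk.1 ▸ hm), zero_mul]
        · rw [hconst m hk (fun l hl => ih l hl (hl.trans hm)), hj m hm]
    refine ⟨hlow, fun hα t => ?_⟩
    by_cases hk : j = 0 ∧ e 0 = 0
    · obtain ⟨rfl, h⟩ := hk
      change (c 0).1 t ≠ 0
      rw [hzero h]
      exact mul_ne_zero hα (phase_ne_zero _ _ _)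
    · change (c j).1 t ≠ 0
      rwa [hconst j hk hlow]

end Formal

/-- The residual `i∂_t u + ∂_x² u + μ|u|²u`. -/
def nlsRes (μ : ℝ) (u : ℝ → ℝ → ℂ) (x t : ℝ) : ℂ :=
  Complex.I * dT u x t + dX (dX u) x t + μ * (u x t ^ 2 * (starRingEnd ℂ) (u x t))

section Residual

variable {μ γ : ℝ} {e : ℕ → ℝ} {c : ℕ → ℝ → ℂ} {N : ℕ}

theorem dX_sub_apply {s : Set ℝ} (hs : IsOpen s) {u v : ℝ → ℝ → ℂ} (hu : SmoothIn s u)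
    (hv : SmoothIn s v) {x : ℝ} (hx : x ∈ s) (t : ℝ) :
    dX (fun x t => u x t - v x t) x t = dX u x t - dX v x t :=
  deriv_fun_sub (hu.differentiableAt_left hs hx t) (hv.differentiableAt_left hs hx t)

theorem dT_sub_apply {s : Set ℝ} (hs : IsOpen s) {u v : ℝ → ℝ → ℂ} (hu : SmoothIn s u)
    (hv : SmoothIn s v) {x : ℝ} (hx : x ∈ s) (t : ℝ) :
    dT (fun x t => u x t - v x t) x t = dT u x t - dT v x t :=
  deriv_fun_sub (hu.differentiableAt_right hs hx t) (hv.differentiableAt_right hs hx t)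

theorem SymClass.nlsRes_sub (μ : ℝ) {F P : ℝ → ℝ → ℂ} (hγ : γ ≤ 0) (hP : SymClass 0 P)
    (hR : SymClass γ (fun x t => F x t - P x t)) :
    SymClass γ (fun x t => nlsRes μ F x t - nlsRes μ P x t) := by
  have hF : SymClass 0 F := ((hR.mono hγ).add hP).congr fun x _ t => by ring
  have hlin := (hR.dT.const_mul Complex.I).add (hR.dX.dX.mono (by linarith : γ - 1 - 1 ≤ γ))
  have h1 := ((hR.mul (hF.add hP)).mul hF.conj).mono (by linarith : γ + 0 + 0 ≤ γ)
  have h2 := ((hP.mul hP).mul hR.conj).mono (by linarith : 0 + 0 + γ ≤ γ)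
  refine (hlin.add ((h1.add h2).const_mul μ)).congr fun x hx t => ?_
  have hdXX : _root_.dX (_root_.dX fun x t => F x t - P x t) x t =
      _root_.dX (_root_.dX F) x t - _root_.dX (_root_.dX P) x t := by
    rw [dX_congr isOpen_Ioi (v := fun x t => _root_.dX F x t - _root_.dX P x t)
      (fun y hy s => dX_sub_apply isOpen_Ioi hF.1 hP.1 hy s) x hx t]
    exact dX_sub_apply isOpen_Ioi (hF.1.dX isOpen_Ioi) (hP.1.dX isOpen_Ioi) hx t
  rw [hdXX, dT_sub_apply isOpen_Ioi hF.1 hP.1 hx t, nlsRes, nlsRes, map_sub]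
  ring

/-- The partial sums `∑ k ≤ N, c k t * x ^ e k`. -/
def powerSum (e : ℕ → ℝ) (c : ℕ → ℝ → ℂ) (N : ℕ) (x t : ℝ) : ℂ :=
  ∑ k ∈ Finset.range (N + 1), c k t * ((x ^ e k : ℝ) : ℂ)

theorem symClass_monomial {c : ℝ → ℂ} (hc : ContDiff ℝ ∞ c) (γ : ℝ) :
    SymClass γ (fun x t => c t * ((x ^ γ : ℝ) : ℂ)) :=
  ((symClass_time hc).mul (symClass_rpow γ)).mono (zero_add γ).le

theorem symClass_powerSum (he : StrictAnti e) (h0 : e 0 ≤ 0) (hc : ∀ k, ContDiff ℝ ∞ (c k)) (N : ℕ) :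
    SymClass 0 (powerSum e c N) :=
  SymClass.sum fun k _ => (symClass_monomial (hc k) (e k)).mono
    ((he.antitone (Nat.zero_le k)).trans h0)

theorem dX_sum_rpow {I : Finset ℕ} {g : ℕ → ℝ} {x : ℝ} (hx : 0 < x) (t : ℝ) :
    dX (fun x t => ∑ k ∈ I, c k t * ((x ^ g k : ℝ) : ℂ)) x t =
      ∑ k ∈ I, (g k * c k t) * ((x ^ (g k - 1) : ℝ) : ℂ) := by
  have h : HasDerivAt (fun x : ℝ => ∑ k ∈ I, c k t * ((x ^ g k : ℝ) : ℂ)) _ x :=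
    HasDerivAt.fun_sum fun k _ => (hasDerivAt_ofReal_rpow (g k) hx).const_mul (c k t)
  refine h.deriv.trans (Finset.sum_congr rfl fun k _ => ?_)
  ring

theorem nlsRes_powerSum (hc : ∀ k, ContDiff ℝ ∞ (c k)) {x : ℝ} (hx : 0 < x) (t : ℝ) :
    nlsRes μ (powerSum e c N) x t =
      ∑ k ∈ Finset.range (N + 1), (Complex.I * deriv (c k) t) * ((x ^ e k : ℝ) : ℂ) +
      ∑ l ∈ Finset.range (N + 1),
        (((e l * (e l - 1) : ℝ) : ℂ) * c l t) * ((x ^ (e l - 2) : ℝ) : ℂ) +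
      μ * ∑ p ∈ Finset.range (N + 1) ×ˢ Finset.range (N + 1) ×ˢ Finset.range (N + 1),
        (c p.1 t * c p.2.1 t * (starRingEnd ℂ) (c p.2.2 t)) *
          ((x ^ (e p.1 + e p.2.1 + e p.2.2) : ℝ) : ℂ) := by
  rw [nlsRes]
  congr 1
  · congr 1
    · have h : HasDerivAt (fun t => powerSum e c N x t) _ t := HasDerivAt.fun_sum fun k _ =>
        (((hc k).differentiable (by simp)).differentiableAt (x := t)).hasDerivAt.mul_const
          ((x ^ e k : ℝ) : ℂ)
      rw [show dT (powerSum e c N) x t = _ from h.deriv, Finset.mul_sum]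
      exact Finset.sum_congr rfl fun k _ => by ring
    · rw [dX_congr isOpen_Ioi (fun y hy s => show dX (powerSum e c N) y s = _ from
          dX_sum_rpow (mem_Ioi.1 hy) s) x hx t,
        dX_sum_rpow (c := fun k t => e k * c k t) (g := fun k => e k - 1) hx]
      refine Finset.sum_congr rfl fun k _ => ?_
      rw [show e k - 1 - 1 = e k - 2 by ring]
      push_cast
      ring
  · congr 1
    rw [powerSum, map_sum, sq, Finset.sum_mul_sum, ← Finset.sum_product', Finset.sum_mul_sum,
      ← Finset.sum_product', ← Finset.sum_equiv (Equiv.prodAssoc ℕ ℕ ℕ) (fun _ => ?_)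
        (fun _ _ => rfl)]
    · refine Finset.sum_congr rfl fun p _ => ?_
      simp only [Equiv.prodAssoc_apply, map_mul, Complex.conj_ofReal, Real.rpow_add hx]
      push_cast
      ring
    · simp [and_assoc]

theorem mul_rpow_split (he : StrictAnti e) (hγ : ∃ l, e l = γ) (N : ℕ) (w : ℂ) (x : ℝ) :
    w * ((x ^ γ : ℝ) : ℂ) =
      ∑ k ∈ Finset.range (N + 1), (if γ = e k then w else 0) * ((x ^ e k : ℝ) : ℂ) +
        (if γ ≤ e (N + 1) then w else 0) * ((x ^ γ : ℝ) : ℂ) := by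
  obtain ⟨l, rfl⟩ := hγ
  simp only [he.injective.eq_iff, he.le_iff_ge, ite_mul, zero_mul]
  rw [Finset.sum_ite_eq]
  by_cases h : N + 1 ≤ l
  · rw [if_neg (by simpa using h), if_pos h, zero_add]
  · rw [if_pos (by simpa using h), if_neg h, add_zero]

theorem symClass_nlsRes_powerSum (he : StrictAnti e) (hsub : ∀ k, ∃ l, e l = e k - 2)
    (hadd : ∀ k m, ∃ l, e l = e k + e m) (hc : ∀ k, ContDiff ℝ ∞ (c k))
    (hode : ∀ k N, k < N → ∀ t, Complex.I * deriv (c k) t + formalForcing μ e c N k t = 0) (N : ℕ) :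
    SymClass (e (N + 1)) (nlsRes μ (powerSum e c N)) := by
  have hadd3 : ∀ p : ℕ × ℕ × ℕ, ∃ l, e l = e p.1 + e p.2.1 + e p.2.2 := fun p => by
    obtain ⟨m, hm⟩ := hadd p.1 p.2.1
    exact hm ▸ hadd m p.2.2
  have htail : ∀ {w : ℝ → ℂ} (γ : ℝ), ContDiff ℝ ∞ w → SymClass (e (N + 1))
      (fun x t => (if γ ≤ e (N + 1) then w t else 0) * ((x ^ γ : ℝ) : ℂ)) := fun γ hw => by
    split_ifs with h
    · exact (symClass_monomial hw γ).mono h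
    · simpa using symClass_zero
  refine ((SymClass.sum (I := Finset.range (N + 1)) fun l _ => htail (e l - 2)
    (contDiff_const.mul (hc l) : ContDiff ℝ ∞ fun t => ((e l * (e l - 1) : ℝ) : ℂ) * c l t)).add
    ((SymClass.sum (I := Finset.range (N + 1) ×ˢ Finset.range (N + 1) ×ˢ Finset.range (N + 1))
      fun p _ => htail (e p.1 + e p.2.1 + e p.2.2)
        (((hc p.1).mul (hc p.2.1)).mul (Complex.conjCLE.contDiff.comp (hc p.2.2)))).const_mul
      μ)).congr fun x hx t => ?_
  have hforce : ∑ k ∈ Finset.range (N + 1), formalForcing μ e c (N + 1) k t * ((x ^ e k : ℝ) : ℂ) =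
      ∑ l ∈ Finset.range (N + 1), ∑ k ∈ Finset.range (N + 1),
        (if e l - 2 = e k then ((e l * (e l - 1) : ℝ) : ℂ) * c l t else 0) *
          ((x ^ e k : ℝ) : ℂ) +
      μ * ∑ p ∈ Finset.range (N + 1) ×ˢ Finset.range (N + 1) ×ˢ Finset.range (N + 1),
        ∑ k ∈ Finset.range (N + 1), (if e p.1 + e p.2.1 + e p.2.2 = e k then
          c p.1 t * c p.2.1 t * (starRingEnd ℂ) (c p.2.2 t) else 0) * ((x ^ e k : ℝ) : ℂ) := by
    simp only [formalForcing, add_mul, Finset.sum_add_distrib]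
    congr 1
    · simp only [Finset.sum_mul]
      exact Finset.sum_comm
    · simp only [mul_assoc (μ : ℂ), ← Finset.mul_sum, Finset.sum_mul]
      rw [Finset.sum_comm]
  have hzero : ∑ k ∈ Finset.range (N + 1), (Complex.I * deriv (c k) t +
      formalForcing μ e c (N + 1) k t) * ((x ^ e k : ℝ) : ℂ) = 0 :=
    Finset.sum_eq_zero fun k hk => by rw [hode k _ (Finset.mem_range.1 hk), zero_mul]
  simp only [add_mul, Finset.sum_add_distrib] at hzero
  rw [nlsRes_powerSum hc hx, Finset.sum_congr rfl fun l _ => mul_rpow_split he (hsub l) N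
      (((e l * (e l - 1) : ℝ) : ℂ) * c l t) x, Finset.sum_congr rfl fun p _ =>
      mul_rpow_split he (hadd3 p) N (c p.1 t * c p.2.1 t * (starRingEnd ℂ) (c p.2.2 t)) x,
    Finset.sum_add_distrib, Finset.sum_add_distrib]
  simp only [Function.comp_apply, Complex.conjCLE_apply]
  linear_combination hzero - hforce

theorem exists_half_solution (μ : ℝ) (he : StrictAnti e) (h0 : e 0 ≤ 0)
    (hsub : ∀ k, ∃ l, e l = e k - 2) (hadd : ∀ k m, ∃ l, e l = e k + e m) (α : ℕ → ℂ) :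
    ∃ (c : ℕ → ℝ → ℂ) (F : ℝ → ℝ → ℂ), (∀ k, ContDiff ℝ ∞ (c k)) ∧ (∀ k, c k 0 = α k) ∧
      (∀ j, (∀ m < j, α m = 0) → (∀ m < j, ∀ t, c m t = 0) ∧ (α j ≠ 0 → ∀ t, c j t ≠ 0)) ∧
      Smooth2 F ∧ (∀ x ≤ 0, ∀ t, F x t = 0) ∧
      (∀ N, SymClass (e (N + 1)) (fun x t => F x t - powerSum e c N x t)) ∧
      ∀ N, SymClass (e (N + 1)) (nlsRes μ F) := by
  obtain ⟨c, hc, hc0, hode, hlead⟩ := exists_formal_solution μ he h0 α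
  obtain ⟨F, hF, hF0, hFs⟩ := exists_borel_sum he hc
  refine ⟨c, F, hc, hc0, hlead, hF, hF0, hFs, fun N => ?_⟩
  refine ((SymClass.nlsRes_sub μ ((he.antitone (Nat.zero_le _)).trans h0)
    (symClass_powerSum he h0 hc N) (hFs N)).add
    (symClass_nlsRes_powerSum he hsub hadd hc hode N)).congr fun x _ t => ?_
  ring

end Residual

section Reflection

variable {γ : ℝ} {u : ℝ → ℝ → ℂ}

theorem Smooth2.neg_left (h : Smooth2 u) : Smooth2 fun x t => u (-x) t := fun n =>
  (h n).comp (contDiff_fst.neg.prodMk contDiff_snd)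

theorem norm_iteratedDeriv_neg (g : ℝ → ℂ) (j : ℕ) (x : ℝ) :
    ‖iteratedDeriv j (fun y => g (-y)) x‖ = ‖iteratedDeriv j g (-x)‖ := by
  rw [iteratedDeriv_comp_neg, norm_smul]
  simp

theorem norm_pd_neg_left (u : ℝ → ℝ → ℂ) (i j : ℕ) (x t : ℝ) :
    ‖pd (fun x t => u (-x) t) i j x t‖ = ‖pd u i j (-x) t‖ := by
  have h : ∀ s, iteratedDeriv j (fun y => u (-y) s) x =
      (-1 : ℝ) ^ j • iteratedDeriv j (fun y => u y s) (-x) := fun s =>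
    iteratedDeriv_comp_neg j (fun y => u y s) x
  rw [pd, funext h, iteratedDeriv_fun_const_smul_field, norm_smul]
  simp [pd]

theorem nlsRes_neg_left (μ : ℝ) (u : ℝ → ℝ → ℂ) (x t : ℝ) :
    nlsRes μ (fun x t => u (-x) t) x t = nlsRes μ u (-x) t := by
  have h : dX (fun x t => u (-x) t) = fun x t => -dX u (-x) t := by
    funext x t
    exact deriv_comp_neg (fun y => u y t) x
  have h2 : dX (fun x t => -dX u (-x) t) x t = dX (dX u) (-x) t := by
    change deriv (fun y => -(fun z => dX u z t) (-y)) x = _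
    rw [deriv.fun_neg, deriv_comp_neg (fun z => dX u z t), neg_neg]
    rfl
  rw [nlsRes, h, h2]
  rfl

theorem nlsRes_congr {s : Set ℝ} (hs : IsOpen s) {v : ℝ → ℝ → ℂ} (h : ∀ x ∈ s, ∀ t, u x t = v x t)
    (μ : ℝ) : ∀ x ∈ s, ∀ t, nlsRes μ u x t = nlsRes μ v x t := fun x hx t => by
  rw [nlsRes, nlsRes, dT_congr h x hx, dX_congr hs (dX_congr hs h) x hx, h x hx]

theorem Smooth2.nlsRes (h : Smooth2 u) (μ : ℝ) : Smooth2 (nlsRes μ u) := by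
  have h' := smoothIn_univ.2 h
  exact smoothIn_univ.1 ((((smoothIn_const Complex.I).mul (h'.dT isOpen_univ)).add
    ((h'.dX isOpen_univ).dX isOpen_univ)).add ((smoothIn_const μ).mul
      (((h'.mul h').congr fun x _ t => sq (u x t)).mul h'.conj)))

theorem SymClass.pd_bound_neg (h : SymClass γ fun x t => u (-x) t) (i j : ℕ) (R : ℝ) :
    ∃ C > (0 : ℝ), ∀ x : ℝ, x ≤ -1 → ∀ t ∈ Icc (-R) R,
      ‖pd u i j x t‖ ≤ C * (-x) ^ (γ - (j : ℝ)) := by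
  obtain ⟨C, hC, hb⟩ := h.pd_bound i j R
  refine ⟨C, hC, fun x hx t ht => ?_⟩
  have := hb (-x) (by linarith) t ht
  rwa [norm_pd_neg_left, neg_neg] at this

end Reflection

theorem exists_jb_bound {q : ℝ → ℝ → ℂ} (hq : Continuous (Function.uncurry q)) (R : ℝ) (N : ℕ)
    (hp : ∃ C > (0 : ℝ), ∀ x : ℝ, 1 ≤ x → ∀ t ∈ Icc (-R) R, ‖q x t‖ ≤ C * x ^ (-(N : ℝ)))
    (hm : ∃ C > (0 : ℝ), ∀ x : ℝ, x ≤ -1 → ∀ t ∈ Icc (-R) R, ‖q x t‖ ≤ C * (-x) ^ (-(N : ℝ))) :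
    ∃ C > (0 : ℝ), ∀ x : ℝ, ∀ t ∈ Icc (-R) R, ‖q x t‖ ≤ C * jb x ^ (-(N : ℝ)) := by
  obtain ⟨C₁, hC₁, h₁⟩ := hp
  obtain ⟨C₂, hC₂, h₂⟩ := hm
  obtain ⟨C₃, h₃⟩ := ((isCompact_Icc (a := (-1 : ℝ)) (b := 1)).prod
    (isCompact_Icc (a := -R) (b := R))).exists_bound_of_continuousOn hq.continuousOn
  have hjb : ∀ x, 0 < jb x := fun x => Real.sqrt_pos.2 (by positivity)
  have key : ∀ x m K y : ℝ, 0 < m → 0 ≤ K → jb x ≤ 2 * m → y ≤ K * m ^ (-(N : ℝ)) →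
      y ≤ (K * 2 ^ N) * jb x ^ (-(N : ℝ)) := fun x m K y hm hK hx hy => by
    refine hy.trans ?_
    rw [mul_assoc]
    refine mul_le_mul_of_nonneg_left ?_ hK
    calc m ^ (-(N : ℝ)) = 2 ^ N * (2 * m) ^ (-(N : ℝ)) := by
          rw [Real.mul_rpow two_pos.le hm.le, Real.rpow_neg two_pos.le, Real.rpow_natCast,
            mul_inv_cancel_left₀ (by positivity)]
      _ ≤ _ := mul_le_mul_of_nonneg_left
          (Real.rpow_le_rpow_of_nonpos (hjb x) hx (by simp)) (by positivity)
  have hle : ∀ x m : ℝ, 1 ≤ m → x ^ 2 ≤ m ^ 2 → jb x ≤ 2 * m := fun x m hm hx =>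
    Real.sqrt_le_iff.2 ⟨by linarith, by nlinarith⟩
  refine ⟨(C₁ + C₂ + |C₃|) * 2 ^ N, by positivity, fun x t ht => ?_⟩
  rcases le_total 1 x with hx | hx
  · refine key x x _ _ (by linarith) (by positivity) (hle x x hx le_rfl) ((h₁ x hx t ht).trans ?_)
    exact mul_le_mul_of_nonneg_right (by linarith [abs_nonneg C₃]) (by positivity)
  rcases le_total x (-1) with hx' | hx'
  · have : 0 ≤ -x := by linarith
    refine key x (-x) _ _ (by linarith) (by positivity) (hle x (-x) (by linarith) (by simp))
      ((h₂ x hx' t ht).trans ?_)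
    exact mul_le_mul_of_nonneg_right (by linarith [abs_nonneg C₃]) (by positivity)
  · refine key x 1 _ _ one_pos (by positivity) (hle x 1 le_rfl (by nlinarith)) ?_
    rw [Real.one_rpow, mul_one]
    linarith [h₃ (x, t) ⟨⟨hx', hx⟩, ht⟩, le_abs_self C₃,
      show ‖q x t‖ = ‖Function.uncurry q (x, t)‖ from rfl]

section Assembly

variable {e e' : ℕ → ℝ} {β : ℝ}

theorem IsExp.exists_le (he : IsExp β e) (b : ℝ) : ∃ K, ∀ k, K ≤ k → e k ≤ b :=
  Filter.eventually_atTop.1 (he.2.2.eventually_le_atBot b)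

theorem sMinusInfR_of_symClass (he : IsExp β e) {q : ℝ → ℝ → ℂ} (hq : Smooth2 q)
    (hp : ∀ N, SymClass (e (N + 1)) q) (hm : ∀ N, SymClass (e (N + 1)) fun x t => q (-x) t) :
    SMinusInfR q := by
  refine ⟨hq, fun R _ N i j => ?_⟩
  obtain ⟨K, hK⟩ := he.exists_le (-(N : ℝ) + j)
  have hK' := hK (K + 1) (Nat.le_succ K)
  have hpd := hq.pd i j 0
  refine exists_jb_bound hpd.continuous R N ?_ ?_
  · simpa using ((hp K).mono hK').pd_bound i j R
  · simpa using ((hm K).mono hK').pd_bound_neg i j R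

theorem powerSum_extend (he : StrictAnti e) (he' : StrictAnti e') {φ : ℕ → ℕ}
    (hφ : ∀ k, e' (φ k) = e k) (α : ℕ → ℂ) (N : ℕ) (x t : ℝ) :
    powerSum e' (fun k _ => Function.extend φ α 0 k) (φ N) x t =
      powerSum e (fun k _ => α k) N x t := by
  have hmono : StrictMono φ := fun k l hkl => he'.lt_iff_gt.1 (by rw [hφ, hφ]; exact he hkl)
  simp only [powerSum]
  rw [← Finset.sum_subset (s₁ := (Finset.range (N + 1)).image φ), Finset.sum_image
    hmono.injective.injOn]
  · exact Finset.sum_congr rfl fun k _ => by rw [hmono.injective.extend_apply, hφ]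
  · intro k hk
    obtain ⟨l, hl, rfl⟩ := Finset.mem_image.1 hk
    rw [Finset.mem_range, Nat.lt_succ_iff] at hl ⊢
    exact hmono.monotone hl
  · intro k hk hk'
    rw [Function.extend_apply', Pi.zero_apply, zero_mul]
    rintro ⟨l, rfl⟩
    rw [Finset.mem_range, Nat.lt_succ_iff, hmono.le_iff_le] at hk
    exact hk' (Finset.mem_image_of_mem φ (Finset.mem_range.2 (Nat.lt_succ_of_le hk)))

theorem exists_initial_bound (he : IsExp β e) (he' : IsExp β e') (hβ : β ≤ 0) {φ : ℕ → ℕ}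
    (hφ : ∀ k, e' (φ k) = e k) {α : ℕ → ℂ} {c : ℕ → ℝ → ℂ}
    (hc0 : ∀ k, c k 0 = Function.extend φ α 0 k) {u : ℝ → ℝ → ℂ} (hu : Smooth2 u)
    (hus : ∀ N, SymClass (e' (N + 1)) fun x t => u x t - powerSum e' c N x t)
    {w : ℝ → ℂ} (hw : ContDiff ℝ ∞ w)
    (hws : ∀ N j : ℕ, ∃ C > (0 : ℝ), ∀ x : ℝ, 1 ≤ x →
      ‖iteratedDeriv j (fun y => w y - powerSum e (fun k _ => α k) N y 0) x‖ ≤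
        C * x ^ (e (N + 1) - (j : ℝ))) (N j : ℕ) :
    ∃ C > (0 : ℝ), ∀ x : ℝ, 1 ≤ x →
      ‖iteratedDeriv j (fun y => u y 0 - w y) x‖ ≤ C * x ^ (-(N : ℝ)) := by
  have hmono : StrictMono φ := fun k l hkl =>
    he'.2.1.lt_iff_gt.1 (by rw [hφ, hφ]; exact he.2.1 hkl)
  obtain ⟨K₁, hK₁⟩ := he.exists_le (-(N : ℝ))
  obtain ⟨K₂, hK₂⟩ := he'.exists_le (-(N : ℝ))
  set K := max K₁ K₂ with hK
  obtain ⟨C₁, hC₁, h₁⟩ := hws K j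
  obtain ⟨C₂, hC₂, h₂⟩ := (hus (φ K)).pd_bound 0 j 1
  have hsum : ∀ y, powerSum e' c (φ K) y 0 = powerSum e (fun k _ => α k) K y 0 := fun y => by
    rw [← powerSum_extend he.2.1 he'.2.1 hφ α K y 0]
    simp only [powerSum, hc0]
  refine ⟨C₂ + C₁, by positivity, fun x hx => ?_⟩
  have hx0 : 0 < x := by linarith
  have hS : ContDiffAt ℝ j (fun y => powerSum e (fun k _ => α k) K y 0) x :=
    (((symClass_powerSum he.2.1 (he.1.le.trans hβ) (fun k => contDiff_const) K).1.contDiffAt_left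
      isOpen_Ioi hx0 0).of_le (mod_cast le_top))
  have hu0 : ContDiffAt ℝ j (fun y => u y 0) x :=
    ((hu j).comp (contDiff_id.prodMk contDiff_const)).contDiffAt
  have hw0 : ContDiffAt ℝ j w x := (hw.of_le (mod_cast le_top)).contDiffAt
  have h2 := h₂ x hx 0 (by simp)
  simp only [pd, iteratedDeriv_zero, hsum] at h2
  have hsplit : (fun y => u y 0 - w y) = fun y =>
      (u y 0 - powerSum e (fun k _ => α k) K y 0) - (w y - powerSum e (fun k _ => α k) K y 0) := by
    funext y
    ring
  rw [hsplit, iteratedDeriv_fun_sub (hu0.sub hS) (hw0.sub hS), add_mul]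
  have hj : (0 : ℝ) ≤ j := j.cast_nonneg
  have hle₁ : e (K + 1) ≤ -(N : ℝ) := hK₁ _ ((le_max_left _ _).trans (Nat.le_succ K))
  have hle₂ : e' (φ K + 1) ≤ -(N : ℝ) :=
    hK₂ _ ((le_max_right _ _).trans (hmono.le_apply.trans (Nat.le_succ _)))
  refine (norm_sub_le _ _).trans (add_le_add (h2.trans ?_) ((h₁ x hx).trans ?_))
  · exact mul_le_mul_of_nonneg_left (Real.rpow_le_rpow_of_exponent_le hx (by linarith)) hC₂.le
  · exact mul_le_mul_of_nonneg_left (Real.rpow_le_rpow_of_exponent_le hx (by linarith)) hC₁.le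

theorem psumP_re_im (e : ℕ → ℝ) (c : ℕ → ℝ → ℂ) (N : ℕ) (x t : ℝ) :
    psumP e (fun k t => (c k t).re) (fun k t => (c k t).im) N x t = powerSum e c N x t :=
  Finset.sum_congr rfl fun k _ => by rw [mul_comm Complex.I, Complex.re_add_im]

theorem psumM_re_im (e : ℕ → ℝ) (c : ℕ → ℝ → ℂ) (N : ℕ) (x t : ℝ) :
    psumM e (fun k t => (c k t).re) (fun k t => (c k t).im) N x t = powerSum e c N (-x) t :=
  psumP_re_im e c N (-x) t

theorem leading_coefficient (he : StrictAnti e) (he' : StrictAnti e') {φ : ℕ → ℕ}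
    (hφ : ∀ k, e' (φ k) = e k) {a b : ℕ → ℝ} {c : ℕ → ℝ → ℂ} (hc : ∀ k, ContDiff ℝ ∞ (c k))
    (hlead : ∀ j, (∀ m < j, Function.extend φ (fun k => (a k : ℂ) + Complex.I * b k) 0 m = 0) →
      (∀ m < j, ∀ t, c m t = 0) ∧
        (Function.extend φ (fun k => (a k : ℂ) + Complex.I * b k) 0 j ≠ 0 → ∀ t, c j t ≠ 0))
    (j : ℕ) (hj : ∀ m < j, a m = 0 ∧ b m = 0) (hne : a j ≠ 0 ∨ b j ≠ 0) :
    ∃ j', e' j' = e j ∧ Continuous (fun t => (c j' t).re) ∧ Continuous (fun t => (c j' t).im) ∧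
      (∀ t, (c j' t).re ≠ 0 ∨ (c j' t).im ≠ 0) ∧
      ∀ m' < j', ∀ t, (c m' t).re = 0 ∧ (c m' t).im = 0 := by
  have hmono : StrictMono φ := fun k l hkl => he'.lt_iff_gt.1 (by rw [hφ, hφ]; exact he hkl)
  obtain ⟨hlow, hnz⟩ := hlead (φ j) fun m hm => by
    by_cases h : ∃ l, φ l = m
    · obtain ⟨l, rfl⟩ := h
      obtain ⟨ha, hb⟩ := hj l (hmono.lt_iff_lt.1 hm)
      rw [hmono.injective.extend_apply, ha, hb]
      simp
    · rw [Function.extend_apply' _ _ _ h, Pi.zero_apply]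
  refine ⟨φ j, hφ j, Complex.continuous_re.comp (hc _).continuous,
    Complex.continuous_im.comp (hc _).continuous, fun t => ?_, fun m hm t => ?_⟩
  · by_contra! hcon
    refine hnz ?_ t (Complex.ext hcon.1 hcon.2)
    rw [hmono.injective.extend_apply]
    intro h
    have hre := congrArg Complex.re h
    have him := congrArg Complex.im h
    simp at hre him
    exact hne.elim (fun h => h hre) fun h => h him
  · simp [hlow m hm t]

end Assembly

/-- existence of an asymptotic solution of the NLS initial value problem in
`S^β(ℝ × ℝ → ℂ)` for `β ≤ 0`, with the stated behaviour of the leading coefficients. -/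
theorem statement18 (μ : ℝ) (hμ : μ = 1 ∨ μ = -1) (β : ℝ) (hβ : β ≤ 0)
    (w₀ : ℝ → ℂ) (hw₀smooth : ∀ n : ℕ, ContDiff ℝ n w₀)
    (e : ℕ → ℝ) (he : IsExp β e)
    (ap bp am bm : ℕ → ℝ)
    -- `w₀ ∈ S^β(ℝ → ℂ)`, with expansion coefficients `a_k^± + i b_k^±` and exponents `e k`:
    (hasymP : ∀ N j : ℕ, ∃ C > (0 : ℝ), ∀ x : ℝ, 1 ≤ x →
      ‖iteratedDeriv j (fun y => w₀ y - psumP e (fun k _ => ap k) (fun k _ => bp k) N y 0) x‖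
        ≤ C * x ^ (e (N + 1) - (j : ℝ)))
    (hasymM : ∀ N j : ℕ, ∃ C > (0 : ℝ), ∀ x : ℝ, x ≤ -1 →
      ‖iteratedDeriv j (fun y => w₀ y - psumM e (fun k _ => am k) (fun k _ => bm k) N y 0) x‖
        ≤ C * (-x) ^ (e (N + 1) - (j : ℝ))) :
    ∃ f : ℝ → ℝ → ℂ, Smooth2 f ∧
      -- the NLS residual of `f` lies in `S^{-∞}(ℝ × ℝ → ℂ)`:
      SMinusInfR (fun x t =>
        Complex.I * pd f 1 0 x t + pd f 0 2 x t
          + (μ : ℂ) * ((f x t) ^ 2 * (starRingEnd ℂ) (f x t))) ∧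
      -- `f(·,0) − w₀ ∈ S^{-∞}(ℝ → ℂ)`:
      (∀ N j : ℕ, ∃ C > (0 : ℝ), ∀ x : ℝ,
        ‖iteratedDeriv j (fun y => f y 0 - w₀ y) x‖ ≤ C * jb x ^ (-(N : ℝ))) ∧
      -- `f ∈ S^β(ℝ × ℝ → ℂ)`, with the behaviour of the leading coefficients:
      (∃ e' : ℕ → ℝ, IsExp β e' ∧ ∃ Ap Bp Am Bm : ℕ → ℝ → ℝ,
        (∀ k : ℕ, (∀ n : ℕ, ContDiff ℝ n (Ap k)) ∧ (∀ n : ℕ, ContDiff ℝ n (Bp k)) ∧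
          (∀ n : ℕ, ContDiff ℝ n (Am k)) ∧ (∀ n : ℕ, ContDiff ℝ n (Bm k))) ∧
        AsymR f e' Ap Bp Am Bm ∧
        (∀ j : ℕ, (∀ m < j, ap m = 0 ∧ bp m = 0) → (ap j ≠ 0 ∨ bp j ≠ 0) →
          ∃ j' : ℕ, e' j' = e j ∧
            Continuous (Ap j') ∧ Continuous (Bp j') ∧
            (∀ t : ℝ, Ap j' t ≠ 0 ∨ Bp j' t ≠ 0) ∧
            (∀ m' < j', ∀ t : ℝ, Ap m' t = 0 ∧ Bp m' t = 0)) ∧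
        (∀ j : ℕ, (∀ m < j, am m = 0 ∧ bm m = 0) → (am j ≠ 0 ∨ bm j ≠ 0) →
          ∃ j' : ℕ, e' j' = e j ∧
            Continuous (Am j') ∧ Continuous (Bm j') ∧
            (∀ t : ℝ, Am j' t ≠ 0 ∨ Bm j' t ≠ 0) ∧
            (∀ m' < j', ∀ t : ℝ, Am m' t = 0 ∧ Bm m' t = 0))) := by
  obtain ⟨e', he', hφ, hsub, hadd⟩ := exists_closed_exponents hβ he
  choose φ hφ using hφ
  have h0 : e' 0 ≤ 0 := he'.1.le.trans hβ
  obtain ⟨cp, P, hcp, hcp0, hleadp, hP, hP0, hPs, hPr⟩ := exists_half_solution μ he'.2.1 h0 hsub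
    hadd (Function.extend φ (fun k => (ap k : ℂ) + Complex.I * bp k) 0)
  obtain ⟨cm, M, hcm, hcm0, hleadm, hM, hM0, hMs, hMr⟩ := exists_half_solution μ he'.2.1 h0 hsub
    hadd (Function.extend φ (fun k => (am k : ℂ) + Complex.I * bm k) 0)
  set f : ℝ → ℝ → ℂ := fun x t => P x t + M (-x) t with hf
  have hfs : Smooth2 f := fun n => (hP n).add (hM.neg_left n)
  have hfP : ∀ x ∈ Ioi (0 : ℝ), ∀ t, f x t = P x t := fun x hx t => by
    simp only [hf, hM0 (-x) (neg_nonpos.2 (le_of_lt hx)), add_zero]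
  have hfM : ∀ x ∈ Ioi (0 : ℝ), ∀ t, f (-x) t = M x t := fun x hx t => by
    simp only [hf, hP0 (-x) (neg_nonpos.2 (le_of_lt hx)), zero_add, neg_neg]
  have hfPs : ∀ N, SymClass (e' (N + 1)) fun x t => f x t - powerSum e' cp N x t := fun N =>
    (hPs N).congr fun x hx t => by rw [hfP x hx]
  have hfMs : ∀ N, SymClass (e' (N + 1)) fun x t => f (-x) t - powerSum e' cm N x t := fun N =>
    (hMs N).congr fun x hx t => by rw [hfM x hx]
  have hw : ContDiff ℝ ∞ w₀ := contDiff_infty.2 hw₀smooth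
  refine ⟨f, hfs, ?_, fun N j => ?_, e', he', fun k t => (cp k t).re, fun k t => (cp k t).im,
    fun k t => (cm k t).re, fun k t => (cm k t).im, fun k => ?_, ⟨fun R _ N i j => ?_,
      fun R _ N i j => ?_⟩, leading_coefficient he.2.1 he'.2.1 hφ hcp hleadp,
    leading_coefficient he.2.1 he'.2.1 hφ hcm hleadm⟩
  · have hres : (fun x t => Complex.I * pd f 1 0 x t + pd f 0 2 x t +
        (μ : ℂ) * ((f x t) ^ 2 * (starRingEnd ℂ) (f x t))) = nlsRes μ f := by
      simp only [pd_eq_iterate]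
      rfl
    rw [hres]
    refine sMinusInfR_of_symClass he' (hfs.nlsRes μ) (fun N => ?_) fun N => ?_
    · exact (hPr N).congr (nlsRes_congr isOpen_Ioi hfP μ)
    · refine (hMr N).congr fun x hx t => ?_
      rw [← nlsRes_neg_left]
      exact nlsRes_congr isOpen_Ioi hfM μ x hx t
  · obtain ⟨C₁, hC₁, h₁⟩ := exists_initial_bound he he' hβ hφ hcp0 hfs hfPs hw hasymP N j
    obtain ⟨C₂, hC₂, h₂⟩ := exists_initial_bound he he' hβ hφ hcm0 hfs.neg_left hfMs
      (hw.comp contDiff_neg) (fun N j => by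
        obtain ⟨C, hC, h⟩ := hasymM N j
        refine ⟨C, hC, fun x hx => ?_⟩
        have := h (-x) (by linarith)
        rw [← norm_iteratedDeriv_neg, neg_neg] at this
        simp only [psumM, neg_neg] at this
        exact this) N j
    have hq : ContDiff ℝ (j : ℕ) fun y => f y 0 - w₀ y :=
      ((hfs j).comp (contDiff_id.prodMk contDiff_const)).sub (hw₀smooth j)
    obtain ⟨C, hC, h⟩ := exists_jb_bound
      (q := fun x _ => iteratedDeriv j (fun y => f y 0 - w₀ y) x)
      ((hq.continuous_iteratedDeriv j le_rfl).comp continuous_fst) 0 N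
      ⟨C₁, hC₁, fun x hx _ _ => h₁ x hx⟩
      ⟨C₂, hC₂, fun x hx _ _ => by
        have := h₂ (-x) (by linarith)
        rw [← norm_iteratedDeriv_neg] at this
        simp only [Function.comp_apply, neg_neg] at this
        exact this⟩
    exact ⟨C, hC, fun x => h x 0 (by simp)⟩
  · exact ⟨fun n => Complex.reCLM.contDiff.comp ((hcp k).of_le (mod_cast le_top)),
      fun n => Complex.imCLM.contDiff.comp ((hcp k).of_le (mod_cast le_top)),
      fun n => Complex.reCLM.contDiff.comp ((hcm k).of_le (mod_cast le_top)),
      fun n => Complex.imCLM.contDiff.comp ((hcm k).of_le (mod_cast le_top))⟩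
  · simp only [psumP_re_im]
    exact (hfPs N).pd_bound i j R
  · refine SymClass.pd_bound_neg ?_ i j R
    simp only [psumM_re_im, neg_neg]
    exact hfMs N
end
end
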